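/- arXiv:1811.02975 — 2 statements merged into one kernel-verified Lean document; each statement's English description precedes it below -/
import Mathlib

section
/- Let p, q, r be vertices of a quasi-median graph X such that some hyperplane separates q from both p and r. Then there exist a hyperplane C separating q from both p and r, a geodesic γ_p from q to p, and a geodesic γ_r from q to r, such that q is an endpoint of the edge of γ_p dual to C and q is an endpoint of the edge of γ_r dual to C. -/
namespace QM

variable {V : Type*}

/-- `y₁` and `y₂` lie (in this order) on a common geodesic from `x₁` to `x₂`. -/
def OnGeod (X : SimpleGraph V) (x₁ y₁ y₂ x₂ : V) : Prop :=
  X.dist x₁ y₁ + X.dist y₁ y₂ + X.dist y₂ x₂ = X.dist x₁ x₂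

/-- `(y₁, y₂, y₃)` is a `k`-quasi-median triple for `(x₁, x₂, x₃)` (without minimality). -/
def IsQMTriple (X : SimpleGraph V) (x₁ x₂ x₃ y₁ y₂ y₃ : V) (k : ℕ) : Prop :=
  OnGeod X x₁ y₁ y₂ x₂ ∧ OnGeod X x₁ y₁ y₃ x₃ ∧ OnGeod X x₂ y₂ y₃ x₃ ∧
    X.dist y₁ y₂ = k ∧ X.dist y₁ y₃ = k ∧ X.dist y₂ y₃ = k

/-- `y` is a quasi-median of the triple `(x₁, x₂, x₃)`: it is a `k`-quasi-median triple
with `k` as small as possible. -/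
def IsQuasiMedianTriple (X : SimpleGraph V) (x₁ x₂ x₃ : V) (y : V × V × V) : Prop :=
  ∃ k : ℕ, IsQMTriple X x₁ x₂ x₃ y.1 y.2.1 y.2.2 k ∧
    ∀ (k' : ℕ) (z₁ z₂ z₃ : V), IsQMTriple X x₁ x₂ x₃ z₁ z₂ z₃ k' → k ≤ k'

/-- The complete multipartite graph `K_{1,1,2}`: the complete graph on four vertices
with the edge between vertices `2` and `3` removed. -/
def K112 : SimpleGraph (Fin 4) :=
  SimpleGraph.fromRel (fun i j => ¬(i = 2 ∧ j = 3) ∧ ¬(i = 3 ∧ j = 2))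

/-- The 1-skeleton of the 3-cube. -/
def cubeGraph : SimpleGraph (Fin 3 → Bool) :=
  SimpleGraph.fromRel (fun x y => ∃! i, x i ≠ y i)

/-- The 6-cycle. -/
def C6 : SimpleGraph (Fin 6) := SimpleGraph.fromRel (fun i j => j = i + 1)

/-- A set of vertices is convex if it contains every vertex lying on a geodesic between
two of its members. -/
def IsConvexSet (X : SimpleGraph V) (S : Set V) : Prop :=
  ∀ x ∈ S, ∀ y ∈ S, ∀ z : V, X.dist x z + X.dist z y = X.dist x y → z ∈ S

/-- The convex hull of a set of vertices. -/
def convexHullSet (X : SimpleGraph V) (S : Set V) : Set V :=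
  ⋂₀ {T : Set V | S ⊆ T ∧ IsConvexSet X T}

/-- A quasi-median graph: a connected graph in which every triple of vertices has a unique
quasi-median, with no induced `K_{1,1,2}`, and in which the convex hull of every isometrically
embedded 6-cycle is isomorphic to the 3-cube. -/
structure IsQuasiMedian (X : SimpleGraph V) : Prop where
  connected : X.Connected
  uniqueQuasiMedian : ∀ x₁ x₂ x₃ : V, ∃! y : V × V × V, IsQuasiMedianTriple X x₁ x₂ x₃ y
  noK112 : IsEmpty (SimpleGraph.Embedding K112 X)
  hullOfC6IsCube : ∀ f : Fin 6 → V,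
    (∀ i j, C6.Adj i j → X.Adj (f i) (f j)) →
    (∀ i j, X.dist (f i) (f j) = C6.dist i j) →
    Nonempty (SimpleGraph.Iso
      (SimpleGraph.induce (convexHullSet X (Set.range f)) X) cubeGraph)

/-- Two edges are two sides of a common triangle, or opposite sides of a common square. -/
def SideRel (X : SimpleGraph V) (e f : Sym2 V) : Prop :=
  (∃ a b c : V, X.Adj a b ∧ X.Adj a c ∧ X.Adj b c ∧ e = s(a, b) ∧ f = s(a, c)) ∨
  (∃ a b c d : V, X.Adj a b ∧ X.Adj c d ∧ X.Adj a c ∧ X.Adj b d ∧ a ≠ d ∧ b ≠ c ∧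
    e = s(a, b) ∧ f = s(c, d))

/-- The equivalence class of an edge under the equivalence relation generated by `SideRel`. -/
def hypClass (X : SimpleGraph V) (e : Sym2 V) : Set (Sym2 V) :=
  {f | Relation.EqvGen (SideRel X) e f}

/-- A hyperplane: the equivalence class of some edge of `X`. -/
def IsHyperplane (X : SimpleGraph V) (H : Set (Sym2 V)) : Prop :=
  ∃ e ∈ X.edgeSet, H = hypClass X e

/-- The type of hyperplanes of `X`. -/
def Hyperplane (X : SimpleGraph V) := {H : Set (Sym2 V) // IsHyperplane X H}

/-- Edges `e`, `e'` sharing the endpoint `p`, not lying in a common clique, that are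
adjacent sides of a square of `X`: their dual hyperplanes intersect at `p`. -/
def IntersectAt (X : SimpleGraph V) (e e' : Sym2 V) (p : V) : Prop :=
  ∃ a b : V, e = s(p, a) ∧ e' = s(p, b) ∧ X.Adj p a ∧ X.Adj p b ∧ a ≠ b ∧ ¬ X.Adj a b ∧
    ∃ q : V, q ≠ p ∧ X.Adj a q ∧ X.Adj b q

/-- Edges `e`, `e'` sharing the endpoint `p`, not lying in a common clique, and not adjacent
sides of any square of `X`: their dual hyperplanes osculate at `p`. -/
def OsculateAt (X : SimpleGraph V) (e e' : Sym2 V) (p : V) : Prop :=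
  ∃ a b : V, e = s(p, a) ∧ e' = s(p, b) ∧ X.Adj p a ∧ X.Adj p b ∧ a ≠ b ∧ ¬ X.Adj a b ∧
    ¬ ∃ q : V, q ≠ p ∧ X.Adj a q ∧ X.Adj b q

/-- Hyperplanes `H` and `H'` intersect at `p`. -/
def HypIntersectAt (X : SimpleGraph V) (H H' : Hyperplane X) (p : V) : Prop :=
  ∃ e ∈ H.1, ∃ e' ∈ H'.1, IntersectAt X e e' p

/-- Hyperplanes `H` and `H'` osculate at `p`. -/
def HypOsculateAt (X : SimpleGraph V) (H H' : Hyperplane X) (p : V) : Prop :=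
  ∃ e ∈ H.1, ∃ e' ∈ H'.1, OsculateAt X e e' p

/-- Hyperplanes `H` and `H'` intersect. -/
def HypIntersect (X : SimpleGraph V) (H H' : Hyperplane X) : Prop :=
  ∃ p : V, HypIntersectAt X H H' p

/-- Hyperplanes `H` and `H'` osculate. -/
def HypOsculate (X : SimpleGraph V) (H H' : Hyperplane X) : Prop :=
  ∃ p : V, HypOsculateAt X H H' p

/-- The contact graph `𝒞X`: hyperplanes are adjacent iff they intersect or osculate. -/
def contactGraph (X : SimpleGraph V) : SimpleGraph (Hyperplane X) :=
  SimpleGraph.fromRel (fun H H' => HypIntersect X H H' ∨ HypOsculate X H H')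

/-- The crossing graph `ΔX`: hyperplanes are adjacent iff they intersect. -/
def crossingGraph (X : SimpleGraph V) : SimpleGraph (Hyperplane X) :=
  SimpleGraph.fromRel (fun H H' => HypIntersect X H H')

/-- The (vertex set of the) carrier of a hyperplane: all endpoints of its edges. -/
def hypCarrier (X : SimpleGraph V) (H : Hyperplane X) : Set V :=
  {v : V | ∃ e ∈ H.1, v ∈ e}

/-- A set of edges `H` (e.g. a hyperplane) separates `p` from `q` if every walk from `p`
to `q` uses an edge of `H`. -/
def Separates (X : SimpleGraph V) (H : Set (Sym2 V)) (p q : V) : Prop :=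
  ∀ w : X.Walk p q, ∃ e ∈ w.edges, e ∈ H

/-- `f` is a `(λ, c)`-quasi-isometry from `(A, dA)` to `(B, dB)`. -/
def IsQuasiIsometry {A B : Type*} (lam c : ℝ) (dA : A → A → ℝ) (dB : B → B → ℝ)
    (f : A → B) : Prop :=
  (∀ x y : A, dA x y / lam - c ≤ dB (f x) (f y) ∧ dB (f x) (f y) ≤ lam * dA x y + c) ∧
    ∀ b : B, ∃ a : A, dB (f a) b ≤ c

end QM

namespace QM

theorem dist_le_succ_of_adj {V : Type*} {X : SimpleGraph V} (hX : X.Connected) {u v : V}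
    (x : V) (h : X.Adj u v) : X.dist x u ≤ X.dist x v + 1 := by
  have := hX.dist_triangle (u := x) (v := v) (w := u)
  rwa [SimpleGraph.dist_eq_one_iff_adj.2 h.symm] at this

theorem exists_adj_toward {V : Type*} {X : SimpleGraph V} (hX : X.Connected) {u v : V}
    (h : u ≠ v) : ∃ a, X.Adj u a ∧ X.dist u v = X.dist a v + 1 := by
  obtain ⟨w, hw⟩ := hX.exists_walk_length_eq_dist u v
  cases w with
  | nil => exact absurd rfl h
  | cons hadj w' =>
    rename_i a
    refine ⟨a, hadj, ?_⟩
    have h1 := SimpleGraph.dist_le w'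
    have h2 := dist_le_succ_of_adj hX v hadj
    rw [SimpleGraph.dist_comm (u := v), SimpleGraph.dist_comm (u := v)] at h2
    rw [SimpleGraph.Walk.length_cons] at hw
    omega

theorem adj_of_common_edge {V : Type*} {X : SimpleGraph V} (hX : IsQuasiMedian X)
    {a b x y : V} (hab : X.Adj a b) (hax : X.Adj a x) (hbx : X.Adj b x) (hay : X.Adj a y)
    (hby : X.Adj b y) (hxy : x ≠ y) : X.Adj x y := by
  by_contra hn
  have hn' : ¬ X.Adj y x := fun h => hn h.symm
  refine hX.noK112.false ⟨⟨![a, b, x, y], ?_⟩, ?_⟩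
  · intro i j hij
    have := hab.ne; have := hax.ne; have := hbx.ne; have := hay.ne; have := hby.ne
    fin_cases i <;> fin_cases j <;> simp_all
  · intro i j
    change X.Adj (![a, b, x, y] i) (![a, b, x, y] j) ↔ _
    fin_cases i <;> fin_cases j <;>
      simp [K112, hab, hax, hbx, hay, hby, hab.symm, hax.symm, hbx.symm, hay.symm, hby.symm,
        hn, hn']

theorem triangle_condition {V : Type*} {X : SimpleGraph V} (hX : IsQuasiMedian X) {x u v : V}
    (huv : X.Adj u v) (h : X.dist x u = X.dist x v) :
    ∃ w, X.Adj w u ∧ X.Adj w v ∧ X.dist x w + 1 = X.dist x u := by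
  obtain ⟨⟨x', u', v'⟩, ⟨k, ⟨h1, h2, h3, h4, h5, h6⟩, -⟩, -⟩ := hX.uniqueQuasiMedian x u v
  simp only [OnGeod] at h1 h2 h3 h4 h5 h6
  rw [SimpleGraph.dist_eq_one_iff_adj.2 huv] at h3
  have c1 := SimpleGraph.dist_comm (G := X) (u := u') (v := u)
  have c2 := SimpleGraph.dist_comm (G := X) (u := v') (v := v)
  have hk : k = 1 := by omega
  have hu : u = u' := hX.connected.dist_eq_zero_iff.1 (by omega)
  have hv : v = v' := hX.connected.dist_eq_zero_iff.1 (by omega)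
  subst hu hv hk
  exact ⟨x', SimpleGraph.dist_eq_one_iff_adj.1 h4, SimpleGraph.dist_eq_one_iff_adj.1 h5,
    by omega⟩

theorem dist_lt_of_common_adj {V : Type*} {X : SimpleGraph V} (hX : IsQuasiMedian X)
    {x u v w : V} (huv : X.Adj u v) (hwu : X.Adj w u) (hwv : X.Adj w v)
    (h : X.dist x u < X.dist x v) : X.dist x u < X.dist x w := by
  by_contra hn
  have h1 := dist_le_succ_of_adj hX.connected x hwv.symm
  obtain ⟨z, hzw, hzu, hz⟩ := triangle_condition hX (x := x) hwu (by omega)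
  have hzv : z ≠ v := by rintro rfl; omega
  have := adj_of_common_edge hX hwu hzw.symm hzu.symm hwv huv hzv
  have := dist_le_succ_of_adj hX.connected x this.symm
  omega

theorem dist_eq_two {V : Type*} {X : SimpleGraph V} (hX : X.Connected) {a b c : V}
    (hab : X.Adj a b) (hbc : X.Adj b c) (hne : a ≠ c) (hn : ¬ X.Adj a c) :
    X.dist a c = 2 := by
  have h1 := dist_le_succ_of_adj hX a hbc.symm
  rw [SimpleGraph.dist_eq_one_iff_adj.2 hab] at h1
  have h2 : X.dist a c ≠ 0 := fun h => hne (hX.dist_eq_zero_iff.1 h)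
  have h3 : X.dist a c ≠ 1 := fun h => hn (SimpleGraph.dist_eq_one_iff_adj.1 h)
  omega

theorem eq_of_three_common_adj {V : Type*} {X : SimpleGraph V} (hX : IsQuasiMedian X)
    {a d b c z : V} (hab : X.Adj a b) (hac : X.Adj a c) (haz : X.Adj a z) (hdb : X.Adj d b)
    (hdc : X.Adj d c) (hdz : X.Adj d z) (hbc : X.dist b c = 2) (hbz : X.dist b z = 2)
    (hcz : X.dist c z = 2) : a = d := by
  have key : ∀ m, X.Adj m b → X.Adj m c → X.Adj m z →
      IsQuasiMedianTriple X b c z (m, m, m) := by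
    intro m hb hc hz
    refine ⟨0, ?_, fun _ _ _ _ _ => Nat.zero_le _⟩
    simp [IsQMTriple, OnGeod, hbc, hbz, hcz, SimpleGraph.dist_eq_one_iff_adj.2 hb.symm,
      SimpleGraph.dist_eq_one_iff_adj.2 hc, SimpleGraph.dist_eq_one_iff_adj.2 hc.symm,
      SimpleGraph.dist_eq_one_iff_adj.2 hz]
  have := (hX.uniqueQuasiMedian b c z).unique (key a hab hac haz) (key d hdb hdc hdz)
  exact congrArg Prod.fst this

/-- In an induced square, a vertex cannot be equidistant from three of the corners and
farther from the fourth one. -/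
theorem square_dist_ne {V : Type*} {X : SimpleGraph V} (hX : IsQuasiMedian X)
    {x a b c d : V} (hab : X.Adj a b) (hcd : X.Adj c d) (hac : X.Adj a c) (hbd : X.Adj b d)
    (had : a ≠ d) (hbc : b ≠ c) (nad : ¬ X.Adj a d) (nbc : ¬ X.Adj b c)
    (h1 : X.dist x c = X.dist x a) (h2 : X.dist x d = X.dist x a)
    (h3 : X.dist x b = X.dist x a + 1) : False := by
  obtain ⟨w, hwa, hwc, hw⟩ := triangle_condition hX (x := x) hac h1.symm
  have hwd : w ≠ d := by rintro rfl; omega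
  have hwb : w ≠ b := by rintro rfl; omega
  have nwd : ¬ X.Adj w d := fun h =>
    nad (adj_of_common_edge hX hwc hwa hac.symm h hcd had)
  have nwb : ¬ X.Adj w b := fun h => by
    have := dist_le_succ_of_adj hX.connected x h.symm
    omega
  have e1 := dist_eq_two hX.connected hwc hcd hwd nwd
  have e2 := dist_eq_two hX.connected hwa hab hwb nwb
  obtain ⟨z, hzb, hzd, hz⟩ := triangle_condition hX (x := w) hbd (by omega)
  have hzw : X.Adj w z := SimpleGraph.dist_eq_one_iff_adj.1 (by omega)
  have g := dist_lt_of_common_adj hX hbd.symm hzd hzb (x := x) (by omega)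
  have := dist_le_succ_of_adj hX.connected x hzw.symm
  omega

theorem cubeGraph_adj_iff (x y : Fin 3 → Bool) : cubeGraph.Adj x y ↔
    (x 0 ^^ y 0, x 1 ^^ y 1, x 2 ^^ y 2) ∈
      [(true, false, false), (false, true, false), (false, false, true)] := by
  have key : (∃! i, x i ≠ y i) ↔ (x 0 ^^ y 0, x 1 ^^ y 1, x 2 ^^ y 2) ∈
      [(true, false, false), (false, true, false), (false, false, true)] := by
    simp only [ExistsUnique, Fin.exists_fin_succ, Fin.forall_fin_succ]
    cases x 0 <;> cases y 0 <;> cases h1 : x 1 <;> cases h1' : y 1 <;>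
      cases h2 : x 2 <;> cases h2' : y 2 <;> simp [h1, h1', h2, h2']
  rw [← key, cubeGraph, SimpleGraph.fromRel_adj]
  have hsymm : (∃! i, y i ≠ x i) ↔ ∃! i, x i ≠ y i := by simp only [ne_comm]
  rw [hsymm, or_self]
  refine ⟨fun h => h.2, fun h => ⟨?_, h⟩⟩
  rintro rfl
  obtain ⟨i, hi, -⟩ := h
  exact hi rfl

theorem cubeGraph_parity {x y : Fin 3 → Bool} (h : cubeGraph.Adj x y) :
    (y 0 ^^ y 1 ^^ y 2) = !(x 0 ^^ x 1 ^^ x 2) := by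
  rw [cubeGraph_adj_iff] at h
  revert h
  generalize x 0 = x0, x 1 = x1, x 2 = x2, y 0 = y0, y 1 = y1, y 2 = y2
  revert x0 x1 x2 y0 y1 y2
  decide

set_option synthInstance.maxHeartbeats 400000 in
set_option synthInstance.maxSize 100000 in
theorem exists_bool_triple_of_parity : ∀ x0 x1 x2 y0 y1 y2 z0 z1 z2 : Bool,
    (x0, x1, x2) ≠ (y0, y1, y2) → (x0, x1, x2) ≠ (z0, z1, z2) → (y0, y1, y2) ≠ (z0, z1, z2) →
    (y0 ^^ y1 ^^ y2) = (x0 ^^ x1 ^^ x2) → (z0 ^^ z1 ^^ z2) = (y0 ^^ y1 ^^ y2) →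
    ∃ m0 m1 m2,
      (m0 ^^ x0, m1 ^^ x1, m2 ^^ x2) ∈
        [(true, false, false), (false, true, false), (false, false, true)] ∧
      (m0 ^^ y0, m1 ^^ y1, m2 ^^ y2) ∈
        [(true, false, false), (false, true, false), (false, false, true)] ∧
      (m0 ^^ z0, m1 ^^ z1, m2 ^^ z2) ∈
        [(true, false, false), (false, true, false), (false, false, true)] := by
  rintro (_ | _) (_ | _) (_ | _) <;> decide

theorem exists_common_adj_cubeGraph {x y z a b : Fin 3 → Bool} (hxy : x ≠ y) (hxz : x ≠ z)
    (hyz : y ≠ z) (hxa : cubeGraph.Adj x a) (hay : cubeGraph.Adj a y) (hyb : cubeGraph.Adj y b)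
    (hbz : cubeGraph.Adj b z) :
    ∃ m, cubeGraph.Adj m x ∧ cubeGraph.Adj m y ∧ cubeGraph.Adj m z := by
  have p1 : (y 0 ^^ y 1 ^^ y 2) = (x 0 ^^ x 1 ^^ x 2) := by
    rw [cubeGraph_parity hay, cubeGraph_parity hxa, Bool.not_not]
  have p2 : (z 0 ^^ z 1 ^^ z 2) = (y 0 ^^ y 1 ^^ y 2) := by
    rw [cubeGraph_parity hbz, cubeGraph_parity hyb, Bool.not_not]
  suffices h : ∃ m0 m1 m2, cubeGraph.Adj ![m0, m1, m2] x ∧ cubeGraph.Adj ![m0, m1, m2] y ∧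
      cubeGraph.Adj ![m0, m1, m2] z by
    obtain ⟨m0, m1, m2, h⟩ := h
    exact ⟨_, h⟩
  simp only [cubeGraph_adj_iff, Matrix.cons_val]
  have hne : ∀ {s t : Fin 3 → Bool}, s ≠ t → (s 0, s 1, s 2) ≠ (t 0, t 1, t 2) := by
    intro s t h h'
    simp only [Prod.mk.injEq] at h'
    refine h (funext fun i => ?_)
    fin_cases i
    exacts [h'.1, h'.2.1, h'.2.2]
  exact exists_bool_triple_of_parity _ _ _ _ _ _ _ _ _ (hne hxy) (hne hxz) (hne hyz) p1 p2

theorem C6_adj_add_one (i : Fin 6) : C6.Adj i (i + 1) := by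
  simp [C6]

theorem C6_exists_walk (i j : Fin 6) : ∃ w : C6.Walk i j, w.length = (j - i).val := by
  have hs : ∀ (n : ℕ) (hn : n < 6), ∃ w : C6.Walk i (i + ⟨n, hn⟩), w.length = n := by
    intro n hn
    induction n with
    | zero => exact ⟨SimpleGraph.Walk.nil.copy rfl (by simp), by simp⟩
    | succ n ih =>
      obtain ⟨w, hw⟩ := ih (by omega)
      have e : i + ⟨n, by omega⟩ + 1 = i + ⟨n + 1, hn⟩ := by
        ext; simp [Fin.val_add]
        omega
      exact ⟨(w.concat (C6_adj_add_one _)).copy rfl e, by simp [hw]⟩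
  obtain ⟨w, hw⟩ := hs (j - i).val (j - i).isLt
  exact ⟨w.copy rfl (by simp), by simpa using hw⟩

theorem C6_dist_le (i j : Fin 6) : C6.dist i j ≤ min (j - i).val (i - j).val := by
  obtain ⟨w, hw⟩ := C6_exists_walk i j
  obtain ⟨w', hw'⟩ := C6_exists_walk j i
  refine le_min ((SimpleGraph.dist_le w).trans hw.le) ?_
  rw [SimpleGraph.dist_comm]
  exact (SimpleGraph.dist_le w').trans hw'.le

theorem dist_le_C6_dist {V : Type*} {X : SimpleGraph V} (f : C6 →g X) (i j : Fin 6) :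
    X.dist (f i) (f j) ≤ C6.dist i j := by
  obtain ⟨w, hw⟩ := (C6_exists_walk i j).choose.reachable.exists_walk_length_eq_dist
  rw [← hw, ← SimpleGraph.Walk.length_map f]
  exact SimpleGraph.dist_le _

theorem exists_common_adj_of_hexagon {V : Type*} {X : SimpleGraph V} (hX : IsQuasiMedian X)
    {z u b x c v : V} (hzu : X.Adj z u) (hub : X.Adj u b) (hbx : X.Adj b x) (hxc : X.Adj x c)
    (hcv : X.Adj c v) (hvz : X.Adj v z) (zb : X.dist z b = 2) (ux : X.dist u x = 2)
    (bc : X.dist b c = 2) (xv : X.dist x v = 2) (cz : X.dist c z = 2) (vu : X.dist v u = 2)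
    (zx : X.dist z x = 3) (uc : X.dist u c = 3) (bv : X.dist b v = 3) :
    ∃ m, X.Adj m u ∧ X.Adj m v ∧ X.Adj m x := by
  let g : Fin 6 → V := ![z, u, b, x, c, v]
  have hadj : ∀ i j, C6.Adj i j → X.Adj (g i) (g j) := by
    have h1 : ∀ i : Fin 6, X.Adj (g i) (g (i + 1)) := by
      intro i
      fin_cases i
      exacts [hzu, hub, hbx, hxc, hcv, hvz]
    intro i j hij
    rw [C6, SimpleGraph.fromRel_adj] at hij
    rcases hij.2 with rfl | rfl
    exacts [h1 i, (h1 j).symm]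
  have hdist : ∀ i j, min (j - i).val (i - j).val ≤ X.dist (g i) (g j) := by
    have d1 := SimpleGraph.dist_eq_one_iff_adj.2 hzu
    have d2 := SimpleGraph.dist_eq_one_iff_adj.2 hub
    have d3 := SimpleGraph.dist_eq_one_iff_adj.2 hbx
    have d4 := SimpleGraph.dist_eq_one_iff_adj.2 hxc
    have d5 := SimpleGraph.dist_eq_one_iff_adj.2 hcv
    have d6 := SimpleGraph.dist_eq_one_iff_adj.2 hvz
    have h0 : ∀ i : Fin 6, 1 ≤ X.dist (g i) (g (i + 1)) := by
      intro i
      fin_cases i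
      exacts [d1.ge, d2.ge, d3.ge, d4.ge, d5.ge, d6.ge]
    have h1 : ∀ i : Fin 6, 2 ≤ X.dist (g i) (g (i + 2)) := by
      intro i
      fin_cases i
      exacts [zb.ge, ux.ge, bc.ge, xv.ge, cz.ge, vu.ge]
    have h2 : ∀ i : Fin 6, 3 ≤ X.dist (g i) (g (i + 3)) := by
      intro i
      fin_cases i
      exacts [zx.ge, uc.ge, bv.ge, (SimpleGraph.dist_comm.trans zx).ge,
        (SimpleGraph.dist_comm.trans uc).ge, (SimpleGraph.dist_comm.trans bv).ge]
    intro i j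
    obtain ⟨k, rfl⟩ : ∃ k, j = i + k := ⟨j - i, by simp⟩
    rw [add_sub_cancel_left, sub_add_cancel_left]
    fin_cases k
    · exact Nat.zero_le _
    · exact h0 i
    · exact h1 i
    · exact h2 i
    · have := h1 (i + 4)
      rw [show i + 4 + 2 = i from (add_assoc i 4 2).trans (add_zero i),
        SimpleGraph.dist_comm] at this
      exact (min_le_right _ _).trans this
    · have := h0 (i + 5)
      rw [show i + 5 + 1 = i from (add_assoc i 5 1).trans (add_zero i),
        SimpleGraph.dist_comm] at this
      exact (min_le_right _ _).trans this
  obtain ⟨e⟩ := hX.hullOfC6IsCube g hadj fun i j =>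
    le_antisymm (dist_le_C6_dist ⟨g, @hadj⟩ i j) ((C6_dist_le i j).trans (hdist i j))
  have hg : ∀ i, g i ∈ convexHullSet X (Set.range g) := fun i =>
    Set.mem_sInter.2 fun T hT => hT.1 ⟨i, rfl⟩
  let G : Fin 6 → convexHullSet X (Set.range g) := fun i => ⟨g i, hg i⟩
  have hG : ∀ i j, X.Adj (g i) (g j) → cubeGraph.Adj (e (G i)) (e (G j)) := fun i j h =>
    e.map_adj_iff.2 h
  have hne : ∀ i j, X.dist (g i) (g j) = 2 → e (G i) ≠ e (G j) := by
    intro i j h h'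
    have := congrArg Subtype.val (e.injective h')
    change g i = g j at this
    rw [this, SimpleGraph.dist_self] at h
    omega
  obtain ⟨m, m1, m2, m3⟩ := exists_common_adj_cubeGraph (hne 5 1 vu)
    (hne 5 3 (SimpleGraph.dist_comm.trans xv)) (hne 1 3 ux) (hG 5 0 hvz) (hG 0 1 hzu)
    (hG 1 2 hub) (hG 2 3 hbx)
  have hm : ∀ i, cubeGraph.Adj m (e (G i)) → X.Adj (e.symm m).1 (g i) := by
    intro i h
    have h' : cubeGraph.Adj (e (e.symm m)) (e (G i)) := by rwa [e.apply_symm_apply]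
    exact e.map_adj_iff.1 h'
  exact ⟨(e.symm m).1, hm 1 m2, hm 5 m1, hm 3 m3⟩

theorem exists_common_adj_of_dist_two {V : Type*} {X : SimpleGraph V} (hX : IsQuasiMedian X)
    {x u v z c : V} (hzu : X.Adj z u) (hzv : X.Adj z v) (huv : u ≠ v) (nuv : ¬ X.Adj u v)
    (xu : X.dist x u = 2) (xv : X.dist x v = 2) (xz : X.dist x z = 3) (hcv : X.Adj c v)
    (hxc : X.Adj x c) (huc : X.dist u c = 2) :
    ∃ m, X.Adj m u ∧ X.Adj m v ∧ X.Adj m x := by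
  have huv2 := dist_eq_two hX.connected hzu.symm hzv huv nuv
  obtain ⟨t, htc, htv, ht⟩ := triangle_condition hX (x := u) hcv (by omega)
  have hut : X.Adj u t := SimpleGraph.dist_eq_one_iff_adj.1 (by omega)
  have h1 := dist_le_succ_of_adj hX.connected x htc
  rw [SimpleGraph.dist_eq_one_iff_adj.2 hxc] at h1
  have h2 := dist_le_succ_of_adj hX.connected x hut
  by_cases hxt : X.dist x t = 1
  · exact ⟨t, hut.symm, htv, (SimpleGraph.dist_eq_one_iff_adj.1 hxt).symm⟩
  · have hzt : z ≠ t := by rintro rfl; omega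
    have nzt : ¬ X.Adj z t := fun h =>
      nuv (adj_of_common_edge hX h hzu hut.symm hzv htv huv)
    exact (square_dist_ne hX (x := x) hzu.symm htv hut hzv huv hzt nuv nzt (by omega)
      (by omega) (by omega)).elim

theorem quadrangle_condition {V : Type*} {X : SimpleGraph V} (hX : IsQuasiMedian X)
    {x u v z : V} (hzu : X.Adj z u) (hzv : X.Adj z v) (huv : u ≠ v)
    (h : X.dist x u = X.dist x v) (hz : X.dist x z = X.dist x u + 1) :
    ∃ m, X.Adj m u ∧ X.Adj m v ∧ X.dist x m + 1 = X.dist x u := by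
  have hc := hX.connected
  have nuv : ¬ X.Adj u v := fun h' => by
    have := dist_lt_of_common_adj hX hzu.symm h'.symm hzv.symm (x := x) (by omega)
    omega
  have huv2 := dist_eq_two hc hzu.symm hzv huv nuv
  obtain ⟨⟨x', u', v'⟩, ⟨k, ⟨h1, h2, h3, h4, h5, h6⟩, -⟩, -⟩ := hX.uniqueQuasiMedian x u v
  simp only [OnGeod] at h1 h2 h3 h4 h5 h6
  have c1 := SimpleGraph.dist_comm (G := X) (u := u') (v := u)
  have c2 := SimpleGraph.dist_comm (G := X) (u := v') (v := v)
  obtain ⟨hk, hu⟩ | ⟨hk, hu⟩ : (k = 0 ∧ X.dist u u' = 1) ∨ (k = 2 ∧ X.dist u u' = 0) := by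
    omega
  · subst hk
    obtain rfl := hc.dist_eq_zero_iff.1 h4
    obtain rfl := hc.dist_eq_zero_iff.1 h5
    exact ⟨x', (SimpleGraph.dist_eq_one_iff_adj.1 hu).symm,
      SimpleGraph.dist_eq_one_iff_adj.1 (by omega), by omega⟩
  · obtain rfl := hc.dist_eq_zero_iff.1 hu
    obtain rfl := hc.dist_eq_zero_iff.1 (show X.dist v v' = 0 by omega)
    subst hk
    suffices ∃ m, X.Adj m u ∧ X.Adj m v ∧ X.Adj m x' by
      obtain ⟨m, mu, mv, mx⟩ := this
      refine ⟨m, mu, mv, ?_⟩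
      have a1 := dist_le_succ_of_adj hc x mx
      have a2 := dist_le_succ_of_adj hc x mu.symm
      omega
    have xz : X.dist x' z = 3 := by
      have a1 := hc.dist_triangle (u := x) (v := x') (w := z)
      have a2 := dist_le_succ_of_adj hc x' hzu
      omega
    obtain ⟨b, hxb, hb⟩ := exists_adj_toward hc (u := x') (v := u) (by rintro rfl; simp at h4)
    obtain ⟨c, hxc, hcc⟩ := exists_adj_toward hc (u := x') (v := v) (by rintro rfl; simp at h5)
    have hbu : X.Adj b u := SimpleGraph.dist_eq_one_iff_adj.1 (by omega)
    have hcv : X.Adj c v := SimpleGraph.dist_eq_one_iff_adj.1 (by omega)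
    by_cases hcu : X.Adj c u
    · exact ⟨c, hcu, hcv, hxc.symm⟩
    by_cases hbv : X.Adj b v
    · exact ⟨b, hbu, hbv, hxb.symm⟩
    by_cases huc : X.dist u c = 2
    · exact exists_common_adj_of_dist_two hX hzu hzv huv nuv h4 h5 xz hcv hxc huc
    by_cases hvb : X.dist v b = 2
    · obtain ⟨m, m1, m2, m3⟩ := exists_common_adj_of_dist_two hX hzv hzu huv.symm
        (fun h => nuv h.symm) h5 h4 xz hbu hxb hvb
      exact ⟨m, m2, m1, m3⟩
    have near : ∀ {s t : V}, X.Adj x' s → X.dist x' t = 2 → ¬ X.Adj s t → X.dist t s ≠ 2 →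
        X.dist t s = 3 := by
      intro s t hs ht hn h2
      have a1 := dist_le_succ_of_adj hc t hs.symm
      rw [SimpleGraph.dist_comm (u := t) (v := x'), ht] at a1
      have a2 : X.dist t s ≠ 1 := fun h => hn (SimpleGraph.dist_eq_one_iff_adj.1 h).symm
      have a3 : X.dist t s ≠ 0 := fun h => by
        rw [hc.dist_eq_zero_iff.1 h, SimpleGraph.dist_eq_one_iff_adj.2 hs] at ht
        omega
      omega
    have duc := near hxc h4 hcu huc
    have dvb := near hxb h5 hbv hvb
    have dbx := SimpleGraph.dist_eq_one_iff_adj.2 hxb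
    have dcx := SimpleGraph.dist_eq_one_iff_adj.2 hxc
    have zne : ∀ {s : V}, X.Adj x' s → z ≠ s ∧ ¬ X.Adj z s := by
      intro s hs
      rw [← SimpleGraph.dist_eq_one_iff_adj] at hs
      refine ⟨by rintro rfl; omega, fun h => ?_⟩
      have := dist_le_succ_of_adj hc x' h
      omega
    have hbc : b ≠ c := by rintro rfl; exact hcu hbu
    have nbc : ¬ X.Adj b c := fun h => by
      have := dist_le_succ_of_adj hc u h.symm
      rw [SimpleGraph.dist_eq_one_iff_adj.2 hbu.symm] at this
      omega
    exact exists_common_adj_of_hexagon hX hzu hbu.symm hxb.symm hxc hcv hzv.symm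
      (dist_eq_two hc hzu hbu.symm (zne hxb).1 (zne hxb).2)
      (SimpleGraph.dist_comm.trans h4) (dist_eq_two hc hxb.symm hxc hbc nbc) h5
      (SimpleGraph.dist_comm.trans
        (dist_eq_two hc hzv hcv.symm (zne hxc).1 (zne hxc).2))
      (SimpleGraph.dist_comm.trans huv2) (SimpleGraph.dist_comm.trans xz) duc
      (SimpleGraph.dist_comm.trans dvb)

/-- The set of vertices strictly closer to `u` than to `v`. -/
def closer {V : Type*} (X : SimpleGraph V) (u v : V) : Set V :=
  {x | X.dist x u < X.dist x v}

theorem closer_eq_of_triangle {V : Type*} {X : SimpleGraph V} (hX : IsQuasiMedian X)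
    {u v w : V} (huv : X.Adj u v) (huw : X.Adj u w) (hvw : X.Adj v w) :
    closer X u v = closer X u w :=
  Set.Subset.antisymm (fun _ hx => dist_lt_of_common_adj hX huv huw.symm hvw.symm hx)
    fun _ hx => dist_lt_of_common_adj hX huw huv.symm hvw hx

theorem closer_subset_of_square {V : Type*} {X : SimpleGraph V} (hX : IsQuasiMedian X)
    {a b c d : V} (hab : X.Adj a b) (hcd : X.Adj c d) (hac : X.Adj a c) (hbd : X.Adj b d)
    (had : a ≠ d) (hbc : b ≠ c) (nad : ¬ X.Adj a d) (nbc : ¬ X.Adj b c) :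
    closer X a b ⊆ closer X c d := by
  have hc := hX.connected
  have no_alternating : ∀ {x a b c d : V}, X.Adj a b → X.Adj c d → X.Adj a c → X.Adj b d →
      a ≠ d → b ≠ c → ¬ X.Adj b c → X.dist x d = X.dist x a →
      X.dist x b = X.dist x a + 1 → X.dist x c = X.dist x a + 1 → False := by
    intro x a b c d hab hcd hac hbd had hbc nbc h1 h2 h3
    obtain ⟨y, ya, yd, hy⟩ := quadrangle_condition hX hab.symm hbd had h1.symm h2
    have far : ∀ {s : V}, X.dist x s = X.dist x a + 1 → s ≠ y ∧ ¬ X.Adj s y := by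
      intro s hs
      refine ⟨by rintro rfl; omega, fun h => ?_⟩
      have := dist_le_succ_of_adj hc x h
      omega
    exact had (eq_of_three_common_adj hX hab hac ya.symm hbd.symm hcd.symm yd.symm
      (dist_eq_two hc hab.symm hac hbc nbc)
      (dist_eq_two hc hab.symm ya.symm (far h2).1 (far h2).2)
      (dist_eq_two hc hac.symm ya.symm (far h3).1 (far h3).2))
  intro x hx
  simp only [closer, Set.mem_ofPred_eq] at hx ⊢
  by_contra hn
  have t1 := dist_le_succ_of_adj hc x hab.symm
  have t2 := dist_le_succ_of_adj hc x hac.symm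
  have t3 := dist_le_succ_of_adj hc x hbd
  obtain h1 | h1 | h1 : (X.dist x c = X.dist x a + 1 ∧ X.dist x d = X.dist x a) ∨
      (X.dist x c = X.dist x a ∧ X.dist x d = X.dist x a) ∨
      (X.dist x c = X.dist x a + 1 ∧ X.dist x d = X.dist x a + 1) := by omega
  · exact no_alternating hab hcd hac hbd had hbc nbc h1.2 (by omega) h1.1
  · exact square_dist_ne hX hab hcd hac hbd had hbc nad nbc h1.1 h1.2 (by omega)
  · obtain ⟨w, hwc, hwd, hw⟩ := triangle_condition hX (x := x) hcd (by omega)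
    have hwa : a ≠ w := by
      rintro rfl
      exact nad hwd
    have hwb : b ≠ w := by
      rintro rfl
      exact nbc hwc
    have nwa : ¬ X.Adj a w := fun h =>
      nad (adj_of_common_edge hX hwc h.symm hac.symm hwd hcd had)
    have nwb : ¬ X.Adj b w := fun h =>
      nbc (adj_of_common_edge hX hwd h.symm hbd.symm hwc hcd.symm hbc)
    have e1 := dist_eq_two hc hac hwc.symm hwa nwa
    have e2 := dist_eq_two hc hbd hwd.symm hwb nwb
    have c1 := SimpleGraph.dist_comm (G := X) (u := a) (v := w)
    have c2 := SimpleGraph.dist_comm (G := X) (u := b) (v := w)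
    obtain ⟨z, hza, hzb, hz⟩ := triangle_condition hX (x := w) hab (by omega)
    have hwz : X.Adj w z := SimpleGraph.dist_eq_one_iff_adj.1 (by omega)
    have g := dist_lt_of_common_adj hX hab hza hzb hx
    have t4 := dist_le_succ_of_adj hc x hza
    have hzc : z ≠ c := by
      rintro rfl
      exact nbc hzb.symm
    have nzc : ¬ X.Adj z c := fun h =>
      nbc (adj_of_common_edge hX hza hzb hab h hac hbc)
    exact no_alternating hza.symm hwc.symm hac hwz.symm hwa hzc nzc (by omega) (by omega) h1.1

theorem closer_eq_of_square {V : Type*} {X : SimpleGraph V} (hX : IsQuasiMedian X)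
    {a b c d : V} (hab : X.Adj a b) (hcd : X.Adj c d) (hac : X.Adj a c) (hbd : X.Adj b d)
    (had : a ≠ d) (hbc : b ≠ c) (nad : ¬ X.Adj a d) (nbc : ¬ X.Adj b c) :
    closer X a b = closer X c d :=
  (closer_subset_of_square hX hab hcd hac hbd had hbc nad nbc).antisymm
    (closer_subset_of_square hX hcd hab hac.symm hbd.symm hbc.symm had.symm
      (fun h => nbc h.symm) fun h => nad h.symm)

/-- `W` is one of the sectors delimited by the hyperplane dual to the edge `ab`, i.e. the set
of vertices having a given vertex of the maximal clique of `ab` as their projection. -/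
def IsSector {V : Type*} (X : SimpleGraph V) (W : Set V) (a b : V) : Prop :=
  W = closer X a b ∨ W = closer X b a ∨ ∃ z, X.Adj z a ∧ X.Adj z b ∧ W = closer X z a

theorem IsSector.symm {V : Type*} {X : SimpleGraph V} (hX : IsQuasiMedian X) {W : Set V}
    {a b : V} (hab : X.Adj a b) (h : IsSector X W a b) : IsSector X W b a := by
  rcases h with h | h | ⟨z, za, zb, h⟩
  · exact Or.inr (Or.inl h)
  · exact Or.inl h
  · exact Or.inr (Or.inr ⟨z, zb, za, h.trans (closer_eq_of_triangle hX za zb hab)⟩)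

theorem IsSector.of_triangle {V : Type*} {X : SimpleGraph V} (hX : IsQuasiMedian X)
    {W : Set V} {a b c : V} (hab : X.Adj a b) (hac : X.Adj a c) (hbc : X.Adj b c)
    (h : IsSector X W a b) : IsSector X W a c := by
  rcases h with h | h | ⟨z, za, zb, h⟩
  · exact Or.inl (h.trans (closer_eq_of_triangle hX hab hac hbc))
  · exact Or.inr (Or.inr ⟨b, hab.symm, hbc, h⟩)
  · by_cases hzc : z = c
    · subst hzc
      exact Or.inr (Or.inl h)
    · exact Or.inr (Or.inr ⟨z, za,
        adj_of_common_edge hX hab za.symm zb.symm hac hbc hzc, h⟩)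

theorem IsSector.of_square {V : Type*} {X : SimpleGraph V} (hX : IsQuasiMedian X)
    {W : Set V} {a b c d : V} (hab : X.Adj a b) (hcd : X.Adj c d) (hac : X.Adj a c)
    (hbd : X.Adj b d) (had : a ≠ d) (hbc : b ≠ c) (h : IsSector X W a b) :
    IsSector X W c d := by
  by_cases nad : X.Adj a d
  · exact (((h.of_triangle hX hab nad hbd).symm hX nad).of_triangle hX nad.symm hcd.symm
      hac).symm hX hcd.symm
  by_cases nbc : X.Adj b c
  · exact (((h.symm hX hab).of_triangle hX hab.symm nbc hac).symm hX nbc).of_triangle hX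
      nbc.symm hcd hbd
  rcases h with h | h | ⟨z, za, zb, h⟩
  · exact Or.inl (h.trans (closer_eq_of_square hX hab hcd hac hbd had hbc nad nbc))
  · exact Or.inr (Or.inl (h.trans
      (closer_eq_of_square hX hab.symm hcd.symm hbd hac hbc had nbc nad)))
  · have hzc : z ≠ c := by
      rintro rfl
      exact nbc zb.symm
    have hzd : z ≠ d := by
      rintro rfl
      exact nad za.symm
    have nzc : ¬ X.Adj z c := fun h =>
      nbc (adj_of_common_edge hX za zb hab h hac hbc)
    have nzd : ¬ X.Adj z d := fun h =>
      nad (adj_of_common_edge hX zb za hab.symm h hbd had)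
    have e1 := dist_eq_two hX.connected za hac hzc nzc
    have e2 := dist_eq_two hX.connected zb hbd hzd nzd
    obtain ⟨w, wc, wd, hw⟩ := triangle_condition hX (x := z) hcd (by omega)
    have zw : X.Adj z w := SimpleGraph.dist_eq_one_iff_adj.1 (by omega)
    have haw : a ≠ w := by
      rintro rfl
      exact nad wd
    have naw : ¬ X.Adj a w := fun h =>
      nad (adj_of_common_edge hX wc h.symm hac.symm wd hcd had)
    exact Or.inr (Or.inr ⟨w, wc, wd,
      h.trans (closer_eq_of_square hX za wc zw hac hzc haw nzc naw)⟩)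

theorem sideRel_symm {V : Type*} {X : SimpleGraph V} {e f : Sym2 V} (h : SideRel X e f) :
    SideRel X f e := by
  rcases h with ⟨a, b, c, hab, hac, hbc, he, hf⟩ |
    ⟨a, b, c, d, hab, hcd, hac, hbd, had, hbc, he, hf⟩
  · exact Or.inl ⟨a, c, b, hac, hab, hbc.symm, hf, he⟩
  · exact Or.inr ⟨c, d, a, b, hcd, hab, hac.symm, hbd.symm, hbc.symm, had.symm, hf, he⟩

theorem isSector_of_sideRel {V : Type*} {X : SimpleGraph V} (hX : IsQuasiMedian X)
    {W : Set V} {e f : Sym2 V} (h : SideRel X e f)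
    (he : ∃ a b, e = s(a, b) ∧ X.Adj a b ∧ IsSector X W a b) :
    ∃ a b, f = s(a, b) ∧ X.Adj a b ∧ IsSector X W a b := by
  obtain ⟨x, y, rfl, hxy, hW⟩ := he
  rcases h with ⟨a, b, c, hab, hac, hbc, he, rfl⟩ |
    ⟨a, b, c, d, hab, hcd, hac, hbd, had, hbc, he, rfl⟩
  · refine ⟨a, c, rfl, hac, IsSector.of_triangle hX hab hac hbc ?_⟩
    rcases Sym2.eq_iff.1 he with ⟨rfl, rfl⟩ | ⟨rfl, rfl⟩
    exacts [hW, hW.symm hX hxy]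
  · refine ⟨c, d, rfl, hcd, IsSector.of_square hX hab hcd hac hbd had hbc ?_⟩
    rcases Sym2.eq_iff.1 he with ⟨rfl, rfl⟩ | ⟨rfl, rfl⟩
    exacts [hW, hW.symm hX hxy]

theorem isSector_iff_of_eqvGen {V : Type*} {X : SimpleGraph V} (hX : IsQuasiMedian X)
    {W : Set V} {e f : Sym2 V} (h : Relation.EqvGen (SideRel X) e f) :
    (∃ a b, e = s(a, b) ∧ X.Adj a b ∧ IsSector X W a b) ↔
      ∃ a b, f = s(a, b) ∧ X.Adj a b ∧ IsSector X W a b := by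
  induction h with
  | rel e f h => exact ⟨isSector_of_sideRel hX h, isSector_of_sideRel hX (sideRel_symm h)⟩
  | refl e => exact Iff.rfl
  | symm e f _ ih => exact ih.symm
  | trans e f g _ _ ih₁ ih₂ => exact ih₁.trans ih₂

/-- The endpoints of an edge lie in different sectors of the dual hyperplane. -/
theorem not_mem_closer_of_eqvGen {V : Type*} {X : SimpleGraph V} (hX : IsQuasiMedian X)
    {u v x y : V} (huv : X.Adj u v) (h : Relation.EqvGen (SideRel X) s(u, v) s(x, y))
    (hx : x ∈ closer X u v) (hy : y ∈ closer X u v) : False := by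
  obtain ⟨a, b, hab, -, hW⟩ :=
    (isSector_iff_of_eqvGen hX h (W := closer X u v)).1 ⟨u, v, rfl, huv, Or.inl rfl⟩
  have ha : a ∈ closer X u v ∧ b ∈ closer X u v := by
    rcases Sym2.eq_iff.1 hab with ⟨rfl, rfl⟩ | ⟨rfl, rfl⟩
    exacts [⟨hx, hy⟩, ⟨hy, hx⟩]
  rcases hW with h | h | ⟨z, -, -, h⟩ <;> rw [h] at ha <;> simp [closer] at ha

theorem eqvGen_of_mem_closer {V : Type*} {X : SimpleGraph V} (hX : IsQuasiMedian X)
    {u v x y : V} (huv : X.Adj u v) (hxy : X.Adj x y) (hx : x ∈ closer X u v)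
    (hy : y ∈ closer X v u) : Relation.EqvGen (SideRel X) s(u, v) s(x, y) := by
  have hc := hX.connected
  simp only [closer, Set.mem_ofPred_eq] at hx hy
  have dist_eqs : ∀ {x y : V}, X.Adj x y → X.dist x u < X.dist x v → X.dist y v < X.dist y u →
      X.dist x v = X.dist x u + 1 ∧ X.dist y v = X.dist x u ∧ X.dist y u = X.dist x u + 1 := by
    intro x y hxy hx hy
    have t1 := dist_le_succ_of_adj hc x huv.symm
    have t2 := dist_le_succ_of_adj hc u hxy
    have t3 := dist_le_succ_of_adj hc u hxy.symm
    have t4 := dist_le_succ_of_adj hc v hxy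
    have t5 := dist_le_succ_of_adj hc v hxy.symm
    simp only [SimpleGraph.dist_comm (u := u), SimpleGraph.dist_comm (u := v)] at t2 t3 t4 t5
    omega
  induction hn : X.dist x u generalizing x y with
  | zero =>
    obtain ⟨h1, h2, h3⟩ := dist_eqs hxy hx hy
    obtain rfl := hc.dist_eq_zero_iff.1 hn
    obtain rfl := hc.dist_eq_zero_iff.1 (h2.trans hn)
    exact Relation.EqvGen.refl _
  | succ n ih =>
    obtain ⟨h1, h2, h3⟩ := dist_eqs hxy hx hy
    obtain ⟨x', hxx', hx'⟩ := exists_adj_toward hc (u := x) (v := u) (by rintro rfl; simp at hn)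
    have t1 := dist_le_succ_of_adj hc x' huv.symm
    have t2 := dist_le_succ_of_adj hc v hxx'
    simp only [SimpleGraph.dist_comm (u := v)] at t2
    have hx'y : x' ≠ y := by rintro rfl; omega
    obtain ⟨y', yx', yy, hy'⟩ := quadrangle_condition hX hxx' hxy hx'y (x := v)
      (by simp only [SimpleGraph.dist_comm (u := v)]; omega)
      (by simp only [SimpleGraph.dist_comm (u := v)]; omega)
    have t3 := dist_le_succ_of_adj hc u yy.symm
    simp only [SimpleGraph.dist_comm (u := v), SimpleGraph.dist_comm (u := u)] at hy' t3
    have hy'x : y' ≠ x := by rintro rfl; omega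
    exact (ih yx'.symm (by omega) (by omega) (by omega)).trans _ _ _
      (Relation.EqvGen.rel _ _ (Or.inr ⟨x', y', x, y, yx'.symm, hxy, hxx'.symm, yy, hx'y,
        hy'x, rfl, rfl⟩))

/-- The hyperplane dual to the first edge of a geodesic separates its endpoints. -/
theorem separates_of_dist_lt {V : Type*} {X : SimpleGraph V} (hX : IsQuasiMedian X)
    {u v p : V} (huv : X.Adj u v) (h : X.dist p v < X.dist p u) :
    Separates X (hypClass X s(u, v)) u p := by
  intro w
  have hu : u ∈ closer X u v := by
    simp [closer, SimpleGraph.dist_eq_one_iff_adj.2 huv]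
  have hp : p ∉ closer X u v := fun hp => by
    simp only [closer, Set.mem_ofPred_eq] at hp
    omega
  obtain ⟨d, hd, hx, hy⟩ := w.exists_boundary_dart _ hu hp
  refine ⟨d.edge, List.mem_map.2 ⟨d, hd, rfl⟩, ?_⟩
  obtain ⟨⟨x, y⟩, hxy⟩ := d
  change Relation.EqvGen (SideRel X) s(u, v) s(x, y)
  simp only at hx hy hxy
  rcases lt_trichotomy (X.dist y u) (X.dist y v) with hlt | heq | hgt
  · exact absurd hlt hy
  · obtain ⟨z, zu, zv, hz⟩ := triangle_condition hX huv heq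
    rw [closer_eq_of_triangle hX huv zu.symm zv.symm] at hx
    have hrel : Relation.EqvGen (SideRel X) s(u, v) s(u, z) :=
      Relation.EqvGen.rel _ _ (Or.inl ⟨u, v, z, huv, zu.symm, zv.symm, rfl, rfl⟩)
    refine hrel.trans _ _ _ (eqvGen_of_mem_closer hX zu.symm hxy hx ?_)
    simp only [closer, Set.mem_ofPred_eq]
    omega
  · exact eqvGen_of_mem_closer hX huv hxy hx hgt

theorem exists_dist_of_mem_edges_geodesic {V : Type*} {X : SimpleGraph V} (hX : X.Connected)
    {q p : V} (w : X.Walk q p) (hw : w.length = X.dist q p) {e : Sym2 V} (he : e ∈ w.edges) :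
    ∃ x y, e = s(x, y) ∧ X.Adj x y ∧ X.dist q x + 1 + X.dist y p = X.dist q p := by
  induction w with
  | nil => simp at he
  | @cons q a p hqa w' ih =>
    rw [SimpleGraph.Walk.length_cons] at hw
    have h1 := SimpleGraph.dist_le w'
    have h2 : ∀ s, X.dist q s ≤ X.dist a s + 1 := fun s => by
      have := dist_le_succ_of_adj hX s hqa
      rwa [SimpleGraph.dist_comm (u := s), SimpleGraph.dist_comm (u := s)] at this
    have h3 := h2 p
    rw [SimpleGraph.Walk.edges_cons, List.mem_cons] at he
    rcases he with rfl | he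
    · exact ⟨q, a, rfl, hqa, by rw [SimpleGraph.dist_self]; omega⟩
    · obtain ⟨x, y, rfl, hxy, h⟩ := ih (by omega) he
      refine ⟨x, y, rfl, hxy, ?_⟩
      have h4 := h2 x
      have h5 := hX.dist_triangle (u := q) (v := x) (w := p)
      have h6 := dist_le_succ_of_adj hX p hxy
      rw [SimpleGraph.dist_comm (u := p), SimpleGraph.dist_comm (u := p)] at h6
      omega

theorem exists_geodesic_crossing_at_start {V : Type*} {X : SimpleGraph V}
    (hX : IsQuasiMedian X) {q a p : V} (hqa : X.Adj q a) (h : X.dist q p = X.dist a p + 1) :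
    Separates X (hypClass X s(q, a)) q p ∧
      ∃ γ : X.Walk q p, γ.length = X.dist q p ∧
        (∃ e ∈ γ.edges, e ∈ hypClass X s(q, a) ∧ q ∈ e) ∧
        ∀ e ∈ γ.edges, e ∈ hypClass X s(q, a) → q ∈ e := by
  have hc := hX.connected
  refine ⟨separates_of_dist_lt hX hqa ?_, ?_⟩
  · rw [SimpleGraph.dist_comm (u := p), SimpleGraph.dist_comm (u := p)]
    omega
  obtain ⟨w, hw⟩ := hc.exists_walk_length_eq_dist a p
  refine ⟨SimpleGraph.Walk.cons hqa w, by rw [SimpleGraph.Walk.length_cons]; omega,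
    ⟨s(q, a), by simp, Relation.EqvGen.refl _, by simp⟩, ?_⟩
  intro e he heC
  rw [SimpleGraph.Walk.edges_cons, List.mem_cons] at he
  rcases he with rfl | he
  · simp
  exfalso
  obtain ⟨x, y, rfl, hxy, hd⟩ := exists_dist_of_mem_edges_geodesic hc w hw he
  have t1 := hc.dist_triangle (u := q) (v := x) (w := p)
  have t2 := hc.dist_triangle (u := q) (v := y) (w := p)
  have t3 := dist_le_succ_of_adj hc p hxy
  have t4 := dist_le_succ_of_adj hc a hxy.symm
  simp only [SimpleGraph.dist_comm (u := p)] at t3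
  rw [Sym2.eq_swap] at heC
  refine not_mem_closer_of_eqvGen hX hqa.symm heC (x := x) (y := y) ?_ ?_ <;>
    simp only [closer, Set.mem_ofPred_eq] <;>
    simp only [SimpleGraph.dist_comm (v := a), SimpleGraph.dist_comm (v := q)] <;> omega

/-- In an equilateral triple `p, q, r`, either some neighbour of `q` is closer to both `p` and
`r`, or some triangle at `q` has one vertex closer to `p` and one vertex closer to `r`. -/
theorem exists_common_step_or_triangle {V : Type*} {X : SimpleGraph V} (hX : IsQuasiMedian X)
    {p q r : V} {k : ℕ} (hk : 0 < k) (hqp : X.dist q p = k) (hqr : X.dist q r = k)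
    (hpr : X.dist p r = k) :
    ∃ a b, X.Adj q a ∧ X.Adj q b ∧ (a = b ∨ X.Adj a b) ∧ X.dist q p = X.dist a p + 1 ∧
      X.dist q r = X.dist b r + 1 := by
  have hc := hX.connected
  obtain ⟨b, hqb, hb⟩ := exists_adj_toward hc (u := q) (v := r)
    (by rintro rfl; simp at hqr; omega)
  have t1 := dist_le_succ_of_adj hc p hqb
  have t2 := dist_le_succ_of_adj hc p hqb.symm
  have comm : ∀ s, X.dist p s = X.dist s p := fun s => SimpleGraph.dist_comm
  rcases lt_trichotomy (X.dist p b) k with h | h | h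
  · refine ⟨b, b, hqb, hqb, Or.inl rfl, ?_, hb⟩
    rw [comm] at h t1 t2
    rw [comm] at t1 t2
    omega
  · obtain ⟨a, haq, hab, ha⟩ := triangle_condition hX (x := p) hqb (by rw [comm]; omega)
    refine ⟨a, b, haq.symm, hqb, Or.inr hab, ?_, hb⟩
    rw [comm, comm] at ha
    exact ha.symm
  · obtain ⟨⟨p', b', r'⟩, ⟨l, ⟨h1, h2, h3, h4, h5, h6⟩, -⟩, -⟩ := hX.uniqueQuasiMedian p b r
    simp only [OnGeod] at h1 h2 h3 h4 h5 h6
    have cb := SimpleGraph.dist_comm (G := X) (u := b') (v := b)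
    have hpb : X.dist p b = k + 1 := by rw [comm q] at t2; omega
    obtain ⟨c, hbc, hcb⟩ := exists_adj_toward hc (u := b) (v := b')
      (by rintro rfl; simp at h1 h3; omega)
    have s1 := hc.dist_triangle (u := p) (v := p') (w := c)
    have s2 := hc.dist_triangle (u := p') (v := b') (w := c)
    have s3 := hc.dist_triangle (u := c) (v := b') (w := r)
    have s4 := hc.dist_triangle (u := b') (v := r') (w := r)
    have s5 := dist_le_succ_of_adj hc p hbc
    have cc := SimpleGraph.dist_comm (G := X) (u := b') (v := c)
    have hqc : q ≠ c := by rintro rfl; omega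
    obtain ⟨m, mq, mc, hm⟩ := quadrangle_condition hX (x := p) hqb.symm hbc hqc
      (by rw [comm q]; omega) (by rw [comm q]; omega)
    have s6 := dist_le_succ_of_adj hc r mc
    have s7 := dist_le_succ_of_adj hc r mq.symm
    simp only [SimpleGraph.dist_comm (u := r)] at s6 s7
    rw [comm, comm] at hm
    exact ⟨m, m, mq.symm, mq.symm, Or.inl rfl, hm.symm, by omega⟩

/-- A hyperplane separating `q` from both `p` and `r` forces `q` not to lie on a geodesic
between `p` and `r`. -/
theorem dist_add_dist_ne_of_separates {V : Type*} {X : SimpleGraph V} (hX : IsQuasiMedian X)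
    {p q r : V} {H : Set (Sym2 V)} (hH : IsHyperplane X H) (hp : Separates X H q p)
    (hr : Separates X H q r) : X.dist q p + X.dist q r ≠ X.dist p r := by
  intro h
  have hc := hX.connected
  obtain ⟨w₁, hw₁⟩ := hc.exists_walk_length_eq_dist q p
  obtain ⟨w₂, hw₂⟩ := hc.exists_walk_length_eq_dist q r
  obtain ⟨e₁, he₁, hH₁⟩ := hp w₁
  obtain ⟨e₂, he₂, hH₂⟩ := hr w₂
  obtain ⟨x, y, rfl, hxy, d₁⟩ := exists_dist_of_mem_edges_geodesic hc w₁ hw₁ he₁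
  obtain ⟨x', y', rfl, hxy', d₂⟩ := exists_dist_of_mem_edges_geodesic hc w₂ hw₂ he₂
  obtain ⟨e, -, rfl⟩ := hH
  have s1 := dist_le_succ_of_adj hc r hxy'
  have s2 := dist_le_succ_of_adj hc q hxy'.symm
  have s3 : ∀ s, X.dist p r ≤ X.dist y p + X.dist s y + X.dist s r := fun s => by
    have a1 := hc.dist_triangle (u := p) (v := y) (w := r)
    have a2 := hc.dist_triangle (u := y) (v := s) (w := r)
    rw [SimpleGraph.dist_comm (u := p) (v := y)] at a1
    rw [SimpleGraph.dist_comm (u := y) (v := s)] at a2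
    omega
  have s4 : ∀ s, X.dist s x ≤ X.dist q s + X.dist q x := fun s => by
    have := hc.dist_triangle (u := s) (v := q) (w := x)
    rwa [SimpleGraph.dist_comm (u := s) (v := q)] at this
  have a1 := s3 x'
  have a2 := s3 y'
  have a3 := s4 x'
  have a4 := s4 y'
  simp only [SimpleGraph.dist_comm (u := r)] at s1
  refine not_mem_closer_of_eqvGen hX hxy ((hH₁.symm _ _).trans _ _ _ hH₂) ?_ ?_ <;>
    simp only [closer, Set.mem_ofPred_eq] <;> omega

theorem exists_steps_of_separates {V : Type*} {X : SimpleGraph V} (hX : IsQuasiMedian X)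
    {p q r : V} {H : Set (Sym2 V)} (hH : IsHyperplane X H) (hp : Separates X H q p)
    (hr : Separates X H q r) :
    ∃ a b, X.Adj q a ∧ X.Adj q b ∧ (a = b ∨ X.Adj a b) ∧ X.dist q p = X.dist a p + 1 ∧
      X.dist q r = X.dist b r + 1 := by
  have hc := hX.connected
  have hne := dist_add_dist_ne_of_separates hX hH hp hr
  obtain ⟨⟨q', p', r'⟩, ⟨k, ⟨h1, h2, h3, h4, h5, h6⟩, -⟩, -⟩ := hX.uniqueQuasiMedian q p r
  simp only [OnGeod] at h1 h2 h3 h4 h5 h6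
  have step : ∀ {a t s : V}, X.Adj q a → X.dist q t + X.dist t s = X.dist q s →
      X.dist q t = X.dist a t + 1 → X.dist q s = X.dist a s + 1 := by
    intro a t s hqa h h'
    have a1 := hc.dist_triangle (u := a) (v := t) (w := s)
    have a2 := dist_le_succ_of_adj hc s hqa
    simp only [SimpleGraph.dist_comm (u := s)] at a2
    omega
  by_cases hq : q = q'
  · subst hq
    rw [SimpleGraph.dist_self] at h1 h2
    have cp := SimpleGraph.dist_comm (G := X) (u := p) (v := p')
    obtain ⟨a, b, hqa, hqb, hab, ha, hb⟩ :=
      exists_common_step_or_triangle hX (k := k) (by omega) h4 h5 h6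
    exact ⟨a, b, hqa, hqb, hab, step hqa (by omega) ha, step hqb (by omega) hb⟩
  · obtain ⟨a, hqa, ha⟩ := exists_adj_toward hc hq
    have a1 := hc.dist_triangle (u := q') (v := p') (w := p)
    have a2 := hc.dist_triangle (u := q') (v := r') (w := r)
    have a3 := hc.dist_triangle (u := q) (v := q') (w := p)
    have a4 := hc.dist_triangle (u := q) (v := q') (w := r)
    exact ⟨a, a, hqa, hqa, Or.inl rfl, step hqa (by omega) ha, step hqa (by omega) ha⟩

/-- **Lemma (cancelling hyperplane).** If some hyperplane separates `q` from both `p` and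
`r` in a quasi-median graph `X`, then there are a hyperplane `C` separating `q` from both
`p` and `r`, and geodesics `γp` from `q` to `p` and `γr` from `q` to `r`, such that `q` is
an endpoint of the edge of `γp` dual to `C` and of the edge of `γr` dual to `C`. -/
theorem cancelling_hyperplane {V : Type*} (X : SimpleGraph V) (hX : IsQuasiMedian X)
    (p q r : V) (h : ∃ H : Hyperplane X, Separates X H.1 q p ∧ Separates X H.1 q r) :
    ∃ (C : Hyperplane X) (γp : X.Walk q p) (γr : X.Walk q r),
      Separates X C.1 q p ∧ Separates X C.1 q r ∧
      γp.length = X.dist q p ∧ γr.length = X.dist q r ∧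
      (∃ e ∈ γp.edges, e ∈ C.1 ∧ q ∈ e) ∧ (∀ e ∈ γp.edges, e ∈ C.1 → q ∈ e) ∧
      (∃ e ∈ γr.edges, e ∈ C.1 ∧ q ∈ e) ∧ (∀ e ∈ γr.edges, e ∈ C.1 → q ∈ e) := by
  obtain ⟨H, hp, hr⟩ := h
  obtain ⟨a, b, hqa, hqb, hab, ha, hb⟩ := exists_steps_of_separates hX H.2 hp hr
  have hC : hypClass X s(q, b) = hypClass X s(q, a) := by
    rcases hab with rfl | hab
    · rfl
    · have hrel : Relation.EqvGen (SideRel X) s(q, a) s(q, b) :=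
        Relation.EqvGen.rel _ _ (Or.inl ⟨q, a, b, hqa, hqb, hab, rfl, rfl⟩)
      ext e
      exact ⟨fun h => hrel.trans _ _ _ h, fun h => (hrel.symm _ _).trans _ _ _ h⟩
  obtain ⟨sp, γp, lp, ep, up⟩ := exists_geodesic_crossing_at_start hX hqa ha
  obtain ⟨sr, γr, lr, er, ur⟩ := exists_geodesic_crossing_at_start hX hqb hb
  rw [hC] at sr er ur
  exact ⟨⟨hypClass X s(q, a), s(q, a), hqa, rfl⟩, γp, γr, sp, sr, lp, lr, ep, up, er, ur⟩

end QM
end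

section
/- Let X be a quasi-median graph and let A and B be hyperplanes of X that osculate at a vertex p and lie in the same connected component of the crossing graph ΔX. Then there exists a geodesic A = A_0, A_1, …, A_m = B in ΔX such that A_{i−1} and A_i intersect at p for all 1 ≤ i ≤ m. -/
namespace QM

variable {V : Type*} {X : SimpleGraph V}

/-- A function on vertices that behaves like the distance to a fixed vertex is that distance. -/
lemma dist_eq_of_potential {G : SimpleGraph V} (j : V) (D : V → ℕ) (h0 : ∀ i, D i = 0 ↔ i = j)
    (hlip : ∀ i i', G.Adj i i' → D i ≤ D i' + 1)
    (hdesc : ∀ i, i ≠ j → ∃ i', G.Adj i i' ∧ D i = D i' + 1) (i : V) : G.dist i j = D i := by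
  have lower : ∀ {i k : V} (w : G.Walk i k), D i ≤ D k + w.length := by
    intro i k w
    induction w with
    | nil => simp
    | cons h w ih => have := hlip _ _ h; simp only [SimpleGraph.Walk.length_cons]; omega
  have upper : ∀ n i, D i = n → ∃ w : G.Walk i j, w.length = n := by
    intro n
    induction n with
    | zero => intro i hi; obtain rfl := (h0 i).1 hi; exact ⟨.nil, rfl⟩
    | succ n ih =>
      intro i hi
      have hij : i ≠ j := fun h => by rw [(h0 i).2 h] at hi; omega
      obtain ⟨i', hadj, hD⟩ := hdesc i hij
      obtain ⟨w, hw⟩ := ih i' (by omega)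
      exact ⟨.cons hadj w, by simp [hw]⟩
  obtain ⟨w, hw⟩ := upper _ i rfl
  obtain ⟨w', hw'⟩ := (SimpleGraph.Walk.reachable w).exists_walk_length_eq_dist
  have h1 := SimpleGraph.dist_le w
  have h2 := lower w'
  rw [(h0 j).2 rfl] at h2
  omega

lemma C6_adj_iff (i j : Fin 6) : C6.Adj i j ↔ i ≠ j ∧ (j = i + 1 ∨ i = j + 1) := by
  simp [C6]

lemma C6_dist (i j : Fin 6) : C6.dist i j = min (i - j).val (j - i).val := by
  refine dist_eq_of_potential j (fun i => min (i - j).val (j - i).val) ?_ ?_ ?_ i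
  · revert j; decide
  · simp only [C6_adj_iff]; revert j; decide
  · simp only [C6_adj_iff]; revert j; decide

lemma cubeGraph_adj_iff_s12 (x y : Fin 3 → Bool) :
    cubeGraph.Adj x y ↔ x ≠ y ∧ ∃! i, x i ≠ y i := by
  simp only [cubeGraph, SimpleGraph.fromRel_adj, ne_comm (a := y _), or_self]

/-- The number of coordinates in which two vertices of the cube differ. -/
def cubeDiff (x y : Fin 3 → Bool) : ℕ := (Finset.univ.filter fun i => x i ≠ y i).card

lemma cubeGraph_adj_iff_cubeDiff (x y : Fin 3 → Bool) : cubeGraph.Adj x y ↔ cubeDiff x y = 1 := by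
  rw [cubeGraph_adj_iff_s12, cubeDiff, Finset.card_eq_one, ExistsUnique]
  constructor
  · rintro ⟨-, i, hi, hu⟩
    exact ⟨i, by ext k; simp only [Finset.mem_filter, Finset.mem_univ, true_and,
      Finset.mem_singleton]; exact ⟨hu k, fun h => h ▸ hi⟩⟩
  · rintro ⟨i, hi⟩
    have h : ∀ k, x k ≠ y k ↔ k = i := fun k => by simpa using Finset.ext_iff.1 hi k
    exact ⟨fun e => (h i).2 rfl (congrFun e i), i, (h i).2 rfl, fun k hk => (h k).1 hk⟩

set_option maxRecDepth 100000 in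
lemma cubeDiff_eq_two {x y z : Fin 3 → Bool} (hxy : x ≠ y) (hx : cubeDiff x z = 1)
    (hy : cubeDiff y z = 1) : cubeDiff x y = 2 := by
  revert x y z; decide

set_option maxRecDepth 100000 in
lemma exists_cubeDiff_eq_one {x y z : Fin 3 → Bool} (hxy : cubeDiff x y = 2)
    (hxz : cubeDiff x z = 2) (hyz : cubeDiff y z = 2) :
    ∃ t, cubeDiff t x = 1 ∧ cubeDiff t y = 1 ∧ cubeDiff t z = 1 := by
  refine ⟨fun i => (x i && y i) || (x i && z i) || (y i && z i), ?_⟩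
  revert x y z; decide

/-- In the cube, three distinct vertices that pairwise have common neighbours have a
neighbour in common. -/
lemma cubeGraph_exists_common_adj {x y z a b c : Fin 3 → Bool} (hxy : x ≠ y) (hxz : x ≠ z)
    (hyz : y ≠ z) (hax : cubeGraph.Adj x a) (hay : cubeGraph.Adj y a) (hbx : cubeGraph.Adj x b)
    (hbz : cubeGraph.Adj z b) (hcy : cubeGraph.Adj y c) (hcz : cubeGraph.Adj z c) :
    ∃ t, cubeGraph.Adj t x ∧ cubeGraph.Adj t y ∧ cubeGraph.Adj t z := by
  simp only [cubeGraph_adj_iff_cubeDiff] at *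
  exact exists_cubeDiff_eq_one (cubeDiff_eq_two hxy hax hay) (cubeDiff_eq_two hxz hbx hbz)
    (cubeDiff_eq_two hyz hcy hcz)

namespace IsQuasiMedian

lemma dist_le_of_adj (hX : IsQuasiMedian X) (w : V) {u v : V} (h : X.Adj u v) :
    X.dist w u ≤ X.dist w v + 1 := by
  have := hX.connected.dist_triangle (u := w) (v := v) (w := u)
  rw [SimpleGraph.dist_eq_one_iff_adj.2 h.symm] at this
  exact this

lemma dist_eq_two (hX : IsQuasiMedian X) {u v z : V} (hne : u ≠ v) (hn : ¬ X.Adj u v)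
    (hu : X.Adj u z) (hv : X.Adj v z) : X.dist u v = 2 := by
  have h1 := hX.dist_le_of_adj u hv
  rw [SimpleGraph.dist_eq_one_iff_adj.2 hu] at h1
  have h2 : X.dist u v ≠ 0 := fun h => hne (hX.connected.dist_eq_zero_iff.1 h)
  have h3 : X.dist u v ≠ 1 := fun h => hn (SimpleGraph.dist_eq_one_iff_adj.1 h)
  omega

/-- The endpoints of a geodesic can be moved one step towards each other. -/
lemma exists_adj_closer (hX : IsQuasiMedian X) {u v : V} {n : ℕ} (h : X.dist u v = n + 1) :
    ∃ t, X.Adj u t ∧ X.dist t v = n := by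
  obtain ⟨w, hw⟩ := hX.connected.exists_walk_length_eq_dist u v
  cases w with
  | nil => simp at h
  | cons hadj w' =>
    refine ⟨_, hadj, ?_⟩
    have h1 := SimpleGraph.dist_le w'
    have h2 := hX.dist_le_of_adj v hadj
    rw [SimpleGraph.Walk.length_cons] at hw
    rw [SimpleGraph.dist_comm (u := v), SimpleGraph.dist_comm (u := v)] at h2
    omega

/-- In a quasi-median graph the common neighbours of an edge form a clique. -/
lemma adj_of_adj_edge (hX : IsQuasiMedian X) {a b c d : V} (hab : X.Adj a b) (hac : X.Adj a c)
    (hbc : X.Adj b c) (had : X.Adj a d) (hbd : X.Adj b d) (hcd : c ≠ d) : X.Adj c d := by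
  by_contra hn
  refine hX.noK112.false ⟨⟨![a, b, c, d], ?_⟩, ?_⟩
  · intro i j h
    have := hab.ne; have := hac.ne; have := hbc.ne; have := had.ne; have := hbd.ne
    fin_cases i <;> fin_cases j <;> simp_all
  · intro i j
    change X.Adj (![a, b, c, d] i) (![a, b, c, d] j) ↔ _
    have hn' : ¬ X.Adj d c := fun h => hn h.symm
    fin_cases i <;> fin_cases j <;>
      simp [K112, hab, hac, hbc, had, hbd, hab.symm, hac.symm, hbc.symm, had.symm, hbd.symm, hn,
        hn']

/-- Two vertices of a quasi-median graph do not have three pairwise non-adjacent common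
neighbours. -/
lemma no_K23 (hX : IsQuasiMedian X) {s t a b c : V} (hst : s ≠ t) (hab : a ≠ b) (hac : a ≠ c)
    (hbc : b ≠ c) (nab : ¬ X.Adj a b) (nac : ¬ X.Adj a c) (nbc : ¬ X.Adj b c)
    (sa : X.Adj s a) (sb : X.Adj s b) (sc : X.Adj s c)
    (ta : X.Adj t a) (tb : X.Adj t b) (tc : X.Adj t c) : False := by
  have key : ∀ r, X.Adj r a → X.Adj r b → X.Adj r c → IsQuasiMedianTriple X a b c (r, r, r) := by
    intro r ra rb rc
    refine ⟨0, ?_, fun _ _ _ _ _ => Nat.zero_le _⟩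
    simp only [IsQMTriple, OnGeod, SimpleGraph.dist_self, and_true,
      hX.dist_eq_two hab nab ra.symm rb.symm, hX.dist_eq_two hac nac ra.symm rc.symm,
      hX.dist_eq_two hbc nbc rb.symm rc.symm, SimpleGraph.dist_eq_one_iff_adj.2 ra.symm,
      SimpleGraph.dist_eq_one_iff_adj.2 rb.symm, SimpleGraph.dist_eq_one_iff_adj.2 rb,
      SimpleGraph.dist_eq_one_iff_adj.2 rc]
  exact hst (congrArg Prod.fst
    ((hX.uniqueQuasiMedian a b c).unique (key s sa sb sc) (key t ta tb tc)))

lemma triangle_condition (hX : IsQuasiMedian X) {w u v : V} (huv : X.Adj u v)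
    (h : X.dist w u = X.dist w v) :
    ∃ x, X.Adj x u ∧ X.Adj x v ∧ X.dist w x + 1 = X.dist w u := by
  obtain ⟨⟨y₁, y₂, y₃⟩, ⟨k, ⟨h12, h13, h23, e12, e13, e23⟩, -⟩, -⟩ := hX.uniqueQuasiMedian w u v
  simp only [OnGeod] at *
  have huv1 := SimpleGraph.dist_eq_one_iff_adj.2 huv
  have c1 := SimpleGraph.dist_comm (G := X) (u := y₂) (v := u)
  rcases Nat.eq_zero_or_pos k with hk | hk
  · omega
  have hu : u = y₂ := hX.connected.dist_eq_zero_iff.1 (by omega)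
  have hv : y₃ = v := hX.connected.dist_eq_zero_iff.1 (by omega)
  subst hu hv
  exact ⟨y₁, SimpleGraph.dist_eq_one_iff_adj.1 (by omega),
    SimpleGraph.dist_eq_one_iff_adj.1 (by omega), by omega⟩

lemma exists_common_adj_of_hexagon (hX : IsQuasiMedian X) {y a u z v b : V}
    (ya : X.Adj y a) (au : X.Adj a u) (uz : X.Adj u z) (zv : X.Adj z v) (vb : X.Adj v b)
    (byy : X.Adj b y) (yu : X.dist y u = 2) (yv : X.dist y v = 2) (uv : X.dist u v = 2)
    (az : X.dist a z = 2) (bz : X.dist b z = 2) (ab : X.dist a b = 2) (yz : X.dist y z = 3)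
    (av : X.dist a v = 3) (bu : X.dist b u = 3) :
    ∃ x, X.Adj x y ∧ X.Adj x u ∧ X.Adj x v := by
  have c := fun p q => SimpleGraph.dist_comm (G := X) (u := p) (v := q)
  have d1 := fun {p q} (h : X.Adj p q) => SimpleGraph.dist_eq_one_iff_adj.2 h
  obtain ⟨φ⟩ := hX.hullOfC6IsCube ![y, a, u, z, v, b] (by
      intro i j
      rw [C6_adj_iff]
      fin_cases i <;> fin_cases j <;> simp [ya, au, uz, zv, vb, byy, ya.symm, au.symm, uz.symm,
        zv.symm, vb.symm, byy.symm]) (by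
      intro i j
      rw [C6_dist]
      fin_cases i <;> fin_cases j <;> simp [d1 ya, d1 au, d1 uz, d1 zv, d1 vb, d1 byy, d1 ya.symm,
        d1 au.symm, d1 uz.symm, d1 zv.symm, d1 vb.symm, d1 byy.symm, yu, yv, uv, az, bz, ab, yz,
        av, bu, c u y, c v y, c v u, c z a, c z b, c b a, c z y, c v a, c u b] <;> decide)
  have hm : ∀ i, ![y, a, u, z, v, b] i ∈ convexHullSet X (Set.range ![y, a, u, z, v, b]) :=
    fun i T hT => hT.1 ⟨i, rfl⟩
  have ne : ∀ {p q : V}, X.dist p q = 2 → p ≠ q := by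
    rintro p q h rfl
    simp at h
  obtain ⟨t, ht1, ht2, ht3⟩ := cubeGraph_exists_common_adj
    (x := φ ⟨y, hm 0⟩) (y := φ ⟨u, hm 2⟩) (z := φ ⟨v, hm 4⟩) (a := φ ⟨a, hm 1⟩)
    (b := φ ⟨b, hm 5⟩) (c := φ ⟨z, hm 3⟩)
    (fun h => ne yu (congrArg Subtype.val (φ.injective h)))
    (fun h => ne yv (congrArg Subtype.val (φ.injective h)))
    (fun h => ne uv (congrArg Subtype.val (φ.injective h)))
    (φ.map_adj_iff.2 ya) (φ.map_adj_iff.2 au.symm) (φ.map_adj_iff.2 byy.symm)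
    (φ.map_adj_iff.2 vb) (φ.map_adj_iff.2 uz) (φ.map_adj_iff.2 zv.symm)
  obtain ⟨t, rfl⟩ := φ.surjective t
  exact ⟨t.1, φ.map_adj_iff.1 ht1, φ.map_adj_iff.1 ht2, φ.map_adj_iff.1 ht3⟩

/-- The quadrangle condition with base point `w`, when some path `y a u` runs geodesically away
from `w` with `y` at distance two from `v` and `a` at distance at most two from `v`. -/
lemma quadrangle_condition_of_dist_le_two (hX : IsQuasiMedian X) {w u v z y a : V}
    (huz : X.Adj u z) (hvz : X.Adj v z) (hne : u ≠ v) (nuv : ¬ X.Adj u v)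
    (hu : X.dist w u + 1 = X.dist w z) (hv : X.dist w v + 1 = X.dist w z)
    (ya : X.Adj y a) (au : X.Adj a u) (wy : X.dist w y + 2 = X.dist w u)
    (yv : X.dist y v = 2) (av : X.dist a v ≤ 2) :
    ∃ x, X.Adj x u ∧ X.Adj x v ∧ X.dist w x + 1 = X.dist w u := by
  have adj := fun {p q} (h : X.dist p q = 1) => SimpleGraph.dist_eq_one_iff_adj (G := X).1 h
  have le := fun {q r} (h : X.Adj q r) => hX.dist_le_of_adj w h
  have uv := hX.dist_eq_two hne nuv huz hvz
  have wa : X.dist w a + 1 = X.dist w u := by have := le ya.symm; have := le au.symm; omega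
  have h0 : X.dist a v ≠ 0 := fun h => nuv (hX.connected.dist_eq_zero_iff.1 h ▸ au.symm)
  by_cases h1 : X.dist a v = 1
  · exact ⟨a, au, adj h1, wa⟩
  have h2 : X.dist v a = 2 := by rw [SimpleGraph.dist_comm]; omega
  rw [SimpleGraph.dist_comm] at yv
  have vu : X.dist v u = 2 := by rwa [SimpleGraph.dist_comm]
  obtain ⟨f, fa, fu, vf⟩ := hX.triangle_condition au (h2.trans vu.symm)
  obtain ⟨b, hby, hba, vb⟩ := hX.triangle_condition ya (yv.trans h2.symm)
  have fv := (adj (show X.dist v f = 1 by omega)).symm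
  have hbv := (adj (show X.dist v b = 1 by omega)).symm
  have wb : X.dist w b + 1 = X.dist w u := by have := le hby; have := le hbv.symm; omega
  by_cases hbu : X.Adj b u
  · exact ⟨b, hbu, hbv, wb⟩
  exfalso
  have hub : u ≠ b := by rintro rfl; omega
  have ub := hX.dist_eq_two hub (fun h => hbu h.symm) au.symm hba
  obtain ⟨c, cb, cv, uc⟩ := hX.triangle_condition (w := u) hbv (ub.trans uv.symm)
  have cu := (adj (show X.dist u c = 1 by omega)).symm
  have nadj : ∀ {p q}, X.Adj p u → X.Adj p v → X.Adj q u → X.Adj q v → ¬ X.Adj p q :=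
    fun pu pv qu qv h => nuv (hX.adj_of_adj_edge h pu qu pv qv hne)
  have wf := le fa
  have wc := le cb
  refine hX.no_K23 hne (a := z) (b := c) (c := f) ?_ ?_ ?_ (nadj huz.symm hvz.symm cu cv)
    (nadj huz.symm hvz.symm fu fv) (nadj cu cv fu fv) huz cu.symm fu.symm hvz cv.symm fv.symm
  · rintro rfl; omega
  · rintro rfl; omega
  · rintro rfl
    exact hbu (hX.adj_of_adj_edge fa.symm au fu hba.symm cb hub).symm

lemma quadrangle_condition (hX : IsQuasiMedian X) {w u v z : V} (huz : X.Adj u z)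
    (hvz : X.Adj v z) (hne : u ≠ v) (hu : X.dist w u + 1 = X.dist w z)
    (hv : X.dist w v + 1 = X.dist w z) :
    ∃ x, X.Adj x u ∧ X.Adj x v ∧ X.dist w x + 1 = X.dist w u := by
  have adj := fun {p q} (h : X.dist p q = 1) => SimpleGraph.dist_eq_one_iff_adj (G := X).1 h
  have le := fun p {q r} (h : X.Adj q r) => hX.dist_le_of_adj p h
  by_cases nuv : X.Adj u v
  · exact hX.triangle_condition nuv (by omega)
  have uv := hX.dist_eq_two hne nuv huz hvz
  obtain ⟨⟨y, y₂, y₃⟩, ⟨k, ⟨h12, h13, h23, e12, e13, e23⟩, -⟩, -⟩ := hX.uniqueQuasiMedian w u v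
  simp only [OnGeod] at *
  have c2 := SimpleGraph.dist_comm (G := X) (u := y₂) (v := u)
  rcases Nat.eq_zero_or_pos k with hk | hk
  · obtain rfl := hX.connected.dist_eq_zero_iff.1 (e12.trans hk)
    obtain rfl := hX.connected.dist_eq_zero_iff.1 (e13.trans hk)
    exact ⟨y, adj (by omega), adj (by omega), by omega⟩
  obtain rfl := hX.connected.dist_eq_zero_iff.1 (show X.dist u y₂ = 0 by omega)
  obtain rfl := hX.connected.dist_eq_zero_iff.1 (show X.dist y₃ v = 0 by omega)
  obtain ⟨a, ya, au⟩ := hX.exists_adj_closer (show X.dist y u = 1 + 1 by omega)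
  obtain ⟨b, yb, bv⟩ := hX.exists_adj_closer (show X.dist y y₃ = 1 + 1 by omega)
  by_cases av : X.dist a y₃ ≤ 2
  · exact hX.quadrangle_condition_of_dist_le_two huz hvz hne nuv hu hv ya (adj au) (by omega)
      (by omega) av
  by_cases bu : X.dist b u ≤ 2
  · obtain ⟨x, h1, h2, h3⟩ := hX.quadrangle_condition_of_dist_le_two hvz huz hne.symm
      (fun h => nuv h.symm) hv hu yb (adj bv) (by omega) (by omega) bu
    exact ⟨x, h2, h1, by omega⟩
  have t1 := hX.connected.dist_triangle (u := w) (v := y) (w := z)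
  have t2 := hX.connected.dist_triangle (u := w) (v := a) (w := z)
  have t3 := hX.connected.dist_triangle (u := w) (v := b) (w := z)
  have t4 := hX.connected.dist_triangle (u := a) (v := b) (w := y₃)
  have l1 := le w ya.symm
  have l2 := le w yb.symm
  have l3 := le a yb.symm
  rw [SimpleGraph.dist_eq_one_iff_adj.2 ya.symm] at l3
  have l4 := le y huz.symm
  have l5 := le a huz.symm
  have l6 := le b hvz.symm
  have l7 := le y₃ ya.symm
  have l8 := le u yb.symm
  simp only [SimpleGraph.dist_comm (u := y₃)] at l7
  simp only [SimpleGraph.dist_comm (u := u)] at l8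
  obtain ⟨x, xy, xu, xv⟩ := hX.exists_common_adj_of_hexagon ya (adj au) huz hvz.symm
    (adj bv).symm yb.symm (by omega) (by omega) uv (by omega) (by omega) (by omega) (by omega)
    (by omega) (by omega)
  have m1 := le w xy
  have m2 := le w xu.symm
  exact ⟨x, xu, xv, by omega⟩

end IsQuasiMedian
end QM

namespace QM

variable {V : Type*} {X : SimpleGraph V}

/-- The vertices that are equal or adjacent to each endpoint of `e`. In a quasi-median graph this
is the unique maximal clique containing the edge `e`. -/
def cliqueOf (X : SimpleGraph V) (e : Sym2 V) : Set V := {k | ∀ v ∈ e, k = v ∨ X.Adj k v}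

/-- `g` is the gate of `x` in the maximal clique containing the edge `e`. -/
def IsGate (X : SimpleGraph V) (e : Sym2 V) (x g : V) : Prop :=
  g ∈ cliqueOf X e ∧ ∀ k ∈ cliqueOf X e, k ≠ g → X.dist x k = X.dist x g + 1

/-- `x` and `y` have the same gate in the maximal clique containing the edge `e`. -/
def SameSide (X : SimpleGraph V) (e : Sym2 V) (x y : V) : Prop :=
  ∃ g, IsGate X e x g ∧ IsGate X e y g

/-- `a b d c` is an induced square, with `a b` opposite to `c d`. -/
structure InducedSquare (X : SimpleGraph V) (a b c d : V) : Prop where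
  ab : X.Adj a b
  cd : X.Adj c d
  ac : X.Adj a c
  bd : X.Adj b d
  nad : ¬ X.Adj a d
  nbc : ¬ X.Adj b c
  ad_ne : a ≠ d
  bc_ne : b ≠ c

lemma InducedSquare.symm {a b c d : V} (h : InducedSquare X a b c d) :
    InducedSquare X c d a b :=
  ⟨h.cd, h.ab, h.ac.symm, h.bd.symm, fun k => h.nbc k.symm, fun k => h.nad k.symm, h.bc_ne.symm,
    h.ad_ne.symm⟩

lemma InducedSquare.flip {a b c d : V} (h : InducedSquare X a b c d) :
    InducedSquare X b a d c :=
  ⟨h.ab.symm, h.cd.symm, h.bd, h.ac, h.nbc, h.nad, h.bc_ne, h.ad_ne⟩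

lemma mem_cliqueOf {a b k : V} :
    k ∈ cliqueOf X s(a, b) ↔ (k = a ∨ X.Adj k a) ∧ (k = b ∨ X.Adj k b) := by
  simp [cliqueOf]

lemma left_mem_cliqueOf {a b : V} (h : X.Adj a b) : a ∈ cliqueOf X s(a, b) :=
  mem_cliqueOf.2 ⟨.inl rfl, .inr h⟩

lemma right_mem_cliqueOf {a b : V} (h : X.Adj a b) : b ∈ cliqueOf X s(a, b) :=
  mem_cliqueOf.2 ⟨.inr h.symm, .inl rfl⟩

lemma IsGate.unique {e : Sym2 V} {x g g' : V} (h : IsGate X e x g) (h' : IsGate X e x g') :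
    g = g' := by
  by_contra hne
  have h1 := h.2 g' h'.1 (Ne.symm hne)
  have h2 := h'.2 g h.1 hne
  omega

lemma SameSide.symm {e : Sym2 V} {x y : V} (h : SameSide X e x y) : SameSide X e y x := by
  obtain ⟨g, h1, h2⟩ := h
  exact ⟨g, h2, h1⟩

lemma SameSide.trans {e : Sym2 V} {x y z : V} (h : SameSide X e x y) (h' : SameSide X e y z) :
    SameSide X e x z := by
  obtain ⟨g, h1, h2⟩ := h
  obtain ⟨g', h3, h4⟩ := h'
  obtain rfl := h2.unique h3
  exact ⟨g, h1, h4⟩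

lemma SameSide.congr {e f : Sym2 V} (h : cliqueOf X e = cliqueOf X f) (x y : V) :
    SameSide X e x y ↔ SameSide X f x y := by
  simp only [SameSide, IsGate, h]

lemma SideRel.mem_edgeSet {e f : Sym2 V} (h : SideRel X e f) :
    e ∈ X.edgeSet ∧ f ∈ X.edgeSet := by
  obtain ⟨a, b, c, h1, h2, -, rfl, rfl⟩ | ⟨a, b, c, d, h1, h2, -, -, -, -, rfl, rfl⟩ := h <;>
  exact ⟨h1, h2⟩

lemma mem_edgeSet_iff_of_eqvGen {e f : Sym2 V} (h : Relation.EqvGen (SideRel X) e f) :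
    e ∈ X.edgeSet ↔ f ∈ X.edgeSet := by
  induction h with
  | rel _ _ h => exact ⟨fun _ => h.mem_edgeSet.2, fun _ => h.mem_edgeSet.1⟩
  | refl _ => rfl
  | symm _ _ _ ih => exact ih.symm
  | trans _ _ _ _ _ ih ih' => exact ih.trans ih'

namespace IsQuasiMedian

lemma adj_of_mem_cliqueOf (hX : IsQuasiMedian X) {a b k k' : V} (hab : X.Adj a b)
    (hk : k ∈ cliqueOf X s(a, b)) (hk' : k' ∈ cliqueOf X s(a, b)) (hne : k ≠ k') :
    X.Adj k k' := by
  rw [mem_cliqueOf] at hk hk'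
  obtain ⟨rfl | h1, h2⟩ := hk
  · exact (hk'.1.resolve_left hne.symm).symm
  obtain rfl | h2 := h2
  · exact (hk'.2.resolve_left hne.symm).symm
  obtain ⟨rfl | h3, h4⟩ := hk'
  · exact h1
  obtain rfl | h4 := h4
  · exact h2
  exact hX.adj_of_adj_edge hab h1.symm h2.symm h3.symm h4.symm hne

lemma cliqueOf_eq (hX : IsQuasiMedian X) {a b k k' : V} (hab : X.Adj a b)
    (hk : k ∈ cliqueOf X s(a, b)) (hk' : k' ∈ cliqueOf X s(a, b)) (hne : k ≠ k') :
    cliqueOf X s(k, k') = cliqueOf X s(a, b) := by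
  have sub : ∀ {a b k k' : V}, X.Adj a b → k ∈ cliqueOf X s(a, b) → k' ∈ cliqueOf X s(a, b) →
      cliqueOf X s(a, b) ⊆ cliqueOf X s(k, k') := by
    intro a b k k' hab hk hk' j hj
    exact mem_cliqueOf.2 ⟨or_iff_not_imp_left.2 fun h => hX.adj_of_mem_cliqueOf hab hj hk h,
      or_iff_not_imp_left.2 fun h => hX.adj_of_mem_cliqueOf hab hj hk' h⟩
  exact (sub (hX.adj_of_mem_cliqueOf hab hk hk' hne) (sub hab hk hk' (left_mem_cliqueOf hab))
    (sub hab hk hk' (right_mem_cliqueOf hab))).antisymm (sub hab hk hk')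

lemma exists_isGate (hX : IsQuasiMedian X) {a b : V} (hab : X.Adj a b) (x : V) :
    ∃ g, IsGate X s(a, b) x g := by
  obtain ⟨g, hg, hmin⟩ := (measure (X.dist x)).wf.has_min (cliqueOf X s(a, b))
    ⟨a, left_mem_cliqueOf hab⟩
  refine ⟨g, hg, fun k hk hne => ?_⟩
  have hadj := hX.adj_of_mem_cliqueOf hab hk hg hne
  have h1 := hX.dist_le_of_adj x hadj
  have h2 : X.dist x g ≤ X.dist x k := not_lt.1 (hmin k hk)
  by_contra h3
  obtain ⟨t, tk, tg, ht⟩ := hX.triangle_condition (w := x) hadj (by omega)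
  have h4 : t ∈ cliqueOf X s(k, g) := mem_cliqueOf.2 ⟨.inr tk, .inr tg⟩
  rw [hX.cliqueOf_eq hab hk hg hne] at h4
  have h5 : X.dist x g ≤ X.dist x t := not_lt.1 (hmin t h4)
  omega

lemma isGate_of_lt (hX : IsQuasiMedian X) {a b x g k : V} (hab : X.Adj a b)
    (hg : g ∈ cliqueOf X s(a, b)) (hk : k ∈ cliqueOf X s(a, b)) (hlt : X.dist x g < X.dist x k) :
    IsGate X s(a, b) x g := by
  obtain ⟨g', hg'⟩ := hX.exists_isGate hab x
  by_cases h : g = g'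
  · rwa [h]
  have h1 := hg'.2 g hg h
  by_cases h' : k = g'
  · subst h'; omega
  have h2 := hg'.2 k hk h'
  omega

lemma isGate_self (hX : IsQuasiMedian X) {a b : V} (hab : X.Adj a b) : IsGate X s(a, b) a a :=
  hX.isGate_of_lt hab (left_mem_cliqueOf hab) (right_mem_cliqueOf hab)
    (by simp [SimpleGraph.dist_eq_one_iff_adj.2 hab])

/-- The maximal cliques on opposite sides of an induced square are matched with each other. -/
lemma exists_inducedSquare (hX : IsQuasiMedian X) {a b c d k : V} (h : InducedSquare X a b c d)
    (hk : k ∈ cliqueOf X s(a, b)) (hka : k ≠ a) :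
    ∃ k' ∈ cliqueOf X s(c, d), InducedSquare X a k c k' := by
  by_cases hkb : k = b
  · subst hkb; exact ⟨d, right_mem_cliqueOf h.cd, h⟩
  rw [mem_cliqueOf] at hk
  have ka := hk.1.resolve_left hka
  have kb := hk.2.resolve_left hkb
  have nkc : ¬ X.Adj k c := fun kc =>
    h.nbc (hX.adj_of_adj_edge ka.symm h.ab kb h.ac kc h.bc_ne)
  have nkd : ¬ X.Adj k d := fun kd =>
    h.nad (hX.adj_of_adj_edge kb.symm h.ab.symm ka h.bd kd h.ad_ne)
  have kc_ne : k ≠ c := by rintro rfl; exact h.nbc kb.symm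
  have kd_ne : k ≠ d := by rintro rfl; exact h.nad ka.symm
  have e1 := hX.dist_eq_two kc_ne nkc ka h.ac.symm
  have e2 := hX.dist_eq_two kd_ne nkd kb h.bd.symm
  obtain ⟨t, tc, td, ht⟩ := hX.triangle_condition h.cd (e1.trans e2.symm)
  refine ⟨t, mem_cliqueOf.2 ⟨.inr tc, .inr td⟩, ka.symm, tc.symm, h.ac,
    SimpleGraph.dist_eq_one_iff_adj.1 (by omega), fun hat => ?_, nkc, ?_, kc_ne⟩
  · exact h.nad (hX.adj_of_adj_edge tc.symm h.ac.symm hat.symm h.cd td h.ad_ne)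
  · rintro rfl; exact h.nad td

lemma not_dist_eq_of_inducedSquare (hX : IsQuasiMedian X) {a b c d x : V}
    (h : InducedSquare X a b c d) (hd : X.dist x a = X.dist x d)
    (hb : X.dist x b = X.dist x a + 1) (hc : X.dist x a ≤ X.dist x c) : False := by
  obtain ⟨t, ta, td, ht⟩ := hX.quadrangle_condition (w := x) h.ab h.bd.symm h.ad_ne (by omega)
    (by omega)
  refine hX.no_K23 h.ad_ne (a := t) (b := b) (c := c) ?_ ?_ h.bc_ne (fun k => ?_) (fun k => ?_)
    h.nbc ta.symm h.ab h.ac td.symm h.bd.symm h.cd.symm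
  · rintro rfl; omega
  · rintro rfl; omega
  · have := hX.dist_le_of_adj x k.symm; omega
  · exact h.nad (hX.adj_of_adj_edge k ta h.ac.symm td h.cd h.ad_ne)

lemma dist_lt_of_inducedSquare (hX : IsQuasiMedian X) {a b c d x : V}
    (h : InducedSquare X a b c d) (hg : IsGate X s(a, b) x a) : X.dist x c < X.dist x d := by
  by_contra hlt
  have hb := hg.2 b (right_mem_cliqueOf h.ab) h.ab.ne'
  have h1 := hX.dist_le_of_adj x h.ac
  have h2 := hX.dist_le_of_adj x h.ac.symm
  have h3 := hX.dist_le_of_adj x h.bd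
  by_cases hd : X.dist x a = X.dist x d
  · exact hX.not_dist_eq_of_inducedSquare h hd hb (by omega)
  obtain ⟨t, tc, td, ht⟩ := hX.triangle_condition (w := x) h.cd (by omega)
  obtain ⟨k, hk, hsq⟩ := hX.exists_inducedSquare h.symm (mem_cliqueOf.2 ⟨.inr tc, .inr td⟩) tc.ne
  have hk' := hg.2 k hk hsq.cd.ne'
  exact hX.not_dist_eq_of_inducedSquare hsq.symm (by omega) hk' (by omega)

lemma exists_isGate_of_inducedSquare (hX : IsQuasiMedian X) {a b c d g : V}
    (h : InducedSquare X a b c d) (hg : g ∈ cliqueOf X s(a, b)) :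
    ∃ g', ∀ x, IsGate X s(a, b) x g → IsGate X s(c, d) x g' := by
  by_cases hga : g = a
  · subst hga
    exact ⟨c, fun x hx => hX.isGate_of_lt h.cd (left_mem_cliqueOf h.cd) (right_mem_cliqueOf h.cd)
      (hX.dist_lt_of_inducedSquare h hx)⟩
  obtain ⟨g', hg', hsq⟩ := hX.exists_inducedSquare h hg hga
  refine ⟨g', fun x hx => hX.isGate_of_lt h.cd hg' (left_mem_cliqueOf h.cd)
    (hX.dist_lt_of_inducedSquare hsq.flip ?_)⟩
  simpa only [IsGate, hX.cliqueOf_eq h.ab hg (left_mem_cliqueOf h.ab) hga] using hx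

lemma sameSide_iff_of_sideRel (hX : IsQuasiMedian X) {e f : Sym2 V} (h : SideRel X e f)
    (x y : V) : SameSide X e x y ↔ SameSide X f x y := by
  obtain ⟨a, b, c, hab, hac, hbc, rfl, rfl⟩ |
    ⟨a, b, c, d, hab, hcd, hac, hbd, had, hbc, rfl, rfl⟩ := h
  · exact SameSide.congr (hX.cliqueOf_eq hac (left_mem_cliqueOf hac)
      (mem_cliqueOf.2 ⟨.inr hab.symm, .inr hbc⟩) hab.ne) x y
  by_cases adj : X.Adj a d ∧ X.Adj b c
  · exact SameSide.congr (hX.cliqueOf_eq hab (mem_cliqueOf.2 ⟨.inr hac.symm, .inr adj.2.symm⟩)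
      (mem_cliqueOf.2 ⟨.inr adj.1.symm, .inr hbd.symm⟩) hcd.ne).symm x y
  have hsq : InducedSquare X a b c d :=
    ⟨hab, hcd, hac, hbd, fun k => adj ⟨k, hX.adj_of_adj_edge k hab hbd.symm hac hcd.symm hbc⟩,
      fun k => adj ⟨hX.adj_of_adj_edge k hab.symm hac.symm hbd hcd had, k⟩, had, hbc⟩
  have key : ∀ {a b c d}, InducedSquare X a b c d → SameSide X s(a, b) x y →
      SameSide X s(c, d) x y := by
    rintro a b c d hsq ⟨g, h1, h2⟩
    obtain ⟨g', hg'⟩ := hX.exists_isGate_of_inducedSquare hsq h1.1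
    exact ⟨g', hg' x h1, hg' y h2⟩
  exact ⟨key hsq, key hsq.symm⟩

lemma sameSide_iff_of_eqvGen (hX : IsQuasiMedian X) {e f : Sym2 V}
    (h : Relation.EqvGen (SideRel X) e f) (x y : V) :
    SameSide X e x y ↔ SameSide X f x y := by
  induction h with
  | rel _ _ h => exact hX.sameSide_iff_of_sideRel h x y
  | refl _ => rfl
  | symm _ _ _ ih => exact ih.symm
  | trans _ _ _ _ _ ih ih' => exact ih.trans ih'

lemma eqvGen_of_dist (hX : IsQuasiMedian X) {a b : V} (hab : X.Adj a b) {n : ℕ} :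
    ∀ {x y : V}, X.Adj x y → X.dist x a = n → X.dist y b = n → X.dist x b = n + 1 →
      X.dist y a = n + 1 → Relation.EqvGen (SideRel X) s(a, b) s(x, y) := by
  induction n with
  | zero =>
    intro x y _ h1 h2 _ _
    rw [hX.connected.dist_eq_zero_iff] at h1 h2
    subst h1 h2
    exact .refl _
  | succ n ih =>
    intro x y hxy h1 h2 h3 h4
    have c := fun p q => SimpleGraph.dist_comm (G := X) (u := p) (v := q)
    obtain ⟨x', hxx', hx'⟩ := hX.exists_adj_closer h1
    have l1 := hX.dist_le_of_adj b hxx'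
    have l2 := hX.dist_le_of_adj x' hab.symm
    rw [c b x, c b x'] at l1
    have hne : x' ≠ y := by rintro rfl; omega
    obtain ⟨y', y'x', y'y, hy'⟩ := hX.quadrangle_condition (w := b) hxx'.symm hxy.symm hne
      (by rw [c b x', c b x]; omega) (by rw [c b y, c b x]; omega)
    rw [c b x', c b y'] at hy'
    have l3 := hX.dist_le_of_adj y' hab
    have l4 := hX.dist_le_of_adj a y'y.symm
    rw [c a y, c a y'] at l4
    have hxy' : x ≠ y' := by rintro rfl; omega
    exact (ih y'x'.symm hx' (by omega) (by omega) (by omega)).trans _ _ _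
      (.symm _ _ (.rel _ _ (.inr ⟨x, y, x', y', hxy, y'x'.symm, hxx', y'y.symm, hxy', hne.symm,
        rfl, rfl⟩)))

lemma eqvGen_of_mem_cliqueOf (hX : IsQuasiMedian X) {a b k k' : V} (hab : X.Adj a b)
    (hk : k ∈ cliqueOf X s(a, b)) (hk' : k' ∈ cliqueOf X s(a, b)) (hne : k ≠ k') :
    Relation.EqvGen (SideRel X) s(a, b) s(k, k') := by
  have star : ∀ {a b k : V}, X.Adj a b → k ∈ cliqueOf X s(a, b) → k ≠ a →
      Relation.EqvGen (SideRel X) s(a, b) s(a, k) := by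
    intro a b k hab hk hka
    by_cases hkb : k = b
    · subst hkb; exact .refl _
    · rw [mem_cliqueOf] at hk
      exact .rel _ _ (.inl ⟨a, b, k, hab, (hk.1.resolve_left hka).symm,
        (hk.2.resolve_left hkb).symm, rfl, rfl⟩)
  by_cases hk'a : k' = a
  · subst hk'a
    rw [Sym2.eq_swap (a := k)]
    exact star hab hk hne
  · have ha := left_mem_cliqueOf hab
    have h := star (hX.adj_of_mem_cliqueOf hab hk' ha hk'a)
      (by rwa [hX.cliqueOf_eq hab hk' ha hk'a]) hne
    rw [Sym2.eq_swap, Sym2.eq_swap (a := k')] at h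
    exact (star hab hk' hk'a).trans _ _ _ h

lemma eqvGen_iff_not_sameSide (hX : IsQuasiMedian X) {a b x y : V} (hab : X.Adj a b)
    (hxy : X.Adj x y) :
    Relation.EqvGen (SideRel X) s(a, b) s(x, y) ↔ ¬ SameSide X s(a, b) x y := by
  constructor
  · rintro h hs
    rw [hX.sameSide_iff_of_eqvGen h] at hs
    obtain ⟨g, h1, h2⟩ := hs
    rw [Sym2.eq_swap] at h2
    exact hxy.ne (((hX.isGate_self hxy).unique h1).trans (h2.unique (hX.isGate_self hxy.symm)))
  · intro hs
    obtain ⟨g, hg⟩ := hX.exists_isGate hab x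
    obtain ⟨g', hg'⟩ := hX.exists_isGate hab y
    have hne : g ≠ g' := by rintro rfl; exact hs ⟨g, hg, hg'⟩
    have hadj := hX.adj_of_mem_cliqueOf hab hg.1 hg'.1 hne
    have d1 := hg.2 g' hg'.1 hne.symm
    have d2 := hg'.2 g hg.1 hne
    have l1 := hX.dist_le_of_adj g hxy
    have l2 := hX.dist_le_of_adj g' hxy
    have l3 := hX.dist_le_of_adj g hxy.symm
    have l4 := hX.dist_le_of_adj g' hxy.symm
    simp only [SimpleGraph.dist_comm (u := g), SimpleGraph.dist_comm (u := g')] at l1 l2 l3 l4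
    have h1 := hX.eqvGen_of_dist hadj hxy rfl (by omega) d1 (by omega)
    exact (hX.eqvGen_of_mem_cliqueOf hab hg.1 hg'.1 hne).trans _ _ _ h1

end IsQuasiMedian
end QM

namespace QM

variable {V : Type*} {X : SimpleGraph V}

/-- `x` and `y` lie in the same sector delimited by the hyperplane `J`. -/
def HypSameSide (X : SimpleGraph V) (J : Hyperplane X) (x y : V) : Prop :=
  ∀ e ∈ J.1, SameSide X e x y

namespace Hyperplane

lemma mem_iff {J : Hyperplane X} {e f : Sym2 V} (he : e ∈ J.1) :
    f ∈ J.1 ↔ Relation.EqvGen (SideRel X) e f := by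
  obtain ⟨J, e₀, he₀, rfl⟩ := J
  exact ⟨fun hf => .trans _ _ _ (.symm _ _ he) hf, fun hf => .trans _ _ _ he hf⟩

lemma adj {J : Hyperplane X} {a b : V} (h : s(a, b) ∈ J.1) : X.Adj a b := by
  obtain ⟨J, e₀, he₀, rfl⟩ := J
  exact (mem_edgeSet_iff_of_eqvGen h).1 he₀

lemma exists_mem (J : Hyperplane X) : ∃ a b, s(a, b) ∈ J.1 := by
  obtain ⟨J, e₀, he₀, rfl⟩ := J
  induction e₀ with
  | h a b => exact ⟨a, b, .refl _⟩

lemma eq_of_mem {J H : Hyperplane X} {e : Sym2 V} (hJ : e ∈ J.1) (hH : e ∈ H.1) : J = H :=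
  Subtype.ext (Set.ext fun _ => (mem_iff hJ).trans (mem_iff hH).symm)

lemma mem_of_sideRel {J : Hyperplane X} {e f : Sym2 V} (he : e ∈ J.1) (h : SideRel X e f) :
    f ∈ J.1 :=
  (mem_iff he).2 (.rel _ _ h)

/-- The hyperplane dual to an edge. -/
def ofAdj {a b : V} (h : X.Adj a b) : Hyperplane X := ⟨hypClass X s(a, b), s(a, b), h, rfl⟩

lemma mem_ofAdj {a b : V} (h : X.Adj a b) : s(a, b) ∈ (ofAdj h).1 := .refl _

lemma left_mem_hypCarrier {J : Hyperplane X} {a b : V} (h : s(a, b) ∈ J.1) :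
    a ∈ hypCarrier X J :=
  ⟨_, h, Sym2.mem_mk_left a b⟩

lemma right_mem_hypCarrier {J : Hyperplane X} {a b : V} (h : s(a, b) ∈ J.1) :
    b ∈ hypCarrier X J :=
  ⟨_, h, Sym2.mem_mk_right a b⟩

lemma exists_of_mem_hypCarrier {J : Hyperplane X} {a : V} (h : a ∈ hypCarrier X J) :
    ∃ b, s(a, b) ∈ J.1 := by
  obtain ⟨e, he, hae⟩ := h
  obtain ⟨b, rfl⟩ := hae
  exact ⟨b, he⟩

end Hyperplane

open Hyperplane

lemma HypSameSide.symm {J : Hyperplane X} {x y : V} (h : HypSameSide X J x y) :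
    HypSameSide X J y x := fun e he => (h e he).symm

lemma HypSameSide.trans {J : Hyperplane X} {x y z : V} (h : HypSameSide X J x y)
    (h' : HypSameSide X J y z) : HypSameSide X J x z := fun e he => (h e he).trans (h' e he)

namespace IsQuasiMedian

lemma hypSameSide_iff (hX : IsQuasiMedian X) {J : Hyperplane X} {e : Sym2 V} (he : e ∈ J.1)
    {x y : V} : HypSameSide X J x y ↔ SameSide X e x y :=
  ⟨fun h => h e he, fun h _ hf => (hX.sameSide_iff_of_eqvGen ((mem_iff he).1 hf) x y).1 h⟩

lemma hypSameSide_refl (hX : IsQuasiMedian X) (J : Hyperplane X) (x : V) :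
    HypSameSide X J x x := by
  obtain ⟨a, b, h⟩ := J.exists_mem
  obtain ⟨g, hg⟩ := hX.exists_isGate (adj h) x
  exact (hX.hypSameSide_iff h).2 ⟨g, hg, hg⟩

lemma mem_iff_not_hypSameSide (hX : IsQuasiMedian X) {J : Hyperplane X} {x y : V}
    (hxy : X.Adj x y) : s(x, y) ∈ J.1 ↔ ¬ HypSameSide X J x y := by
  obtain ⟨a, b, h⟩ := J.exists_mem
  rw [hX.hypSameSide_iff h, mem_iff h, hX.eqvGen_iff_not_sameSide (adj h) hxy]

lemma dist_of_hypSameSide (hX : IsQuasiMedian X) {J : Hyperplane X} {x y z : V}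
    (h : s(z, x) ∈ J.1) (hs : HypSameSide X J y z) : X.dist y x = X.dist y z + 1 := by
  obtain ⟨g, h1, h2⟩ := (hX.hypSameSide_iff h).1 hs
  obtain rfl := h2.unique (hX.isGate_self (adj h))
  exact h1.2 x (right_mem_cliqueOf (adj h)) (adj h).ne'

lemma exists_of_not_hypSameSide (hX : IsQuasiMedian X) {J : Hyperplane X} {y z : V}
    (hz : z ∈ hypCarrier X J) (hs : ¬ HypSameSide X J y z) :
    ∃ x, s(z, x) ∈ J.1 ∧ HypSameSide X J y x ∧ X.dist y z = X.dist y x + 1 := by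
  obtain ⟨x, h⟩ := exists_of_mem_hypCarrier hz
  have hzx := adj h
  obtain ⟨g, hg⟩ := hX.exists_isGate hzx y
  have hne : g ≠ z := by
    rintro rfl
    exact hs ((hX.hypSameSide_iff h).2 ⟨g, hg, hX.isGate_self hzx⟩)
  have hzg := hX.adj_of_mem_cliqueOf hzx (left_mem_cliqueOf hzx) hg.1 hne.symm
  have hmem : s(z, g) ∈ J.1 :=
    (mem_iff h).2 (hX.eqvGen_of_mem_cliqueOf hzx (left_mem_cliqueOf hzx) hg.1 hne.symm)
  have hgg : IsGate X s(z, x) g g := by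
    have h1 := hX.isGate_self hzg.symm
    rwa [IsGate, hX.cliqueOf_eq hzx hg.1 (left_mem_cliqueOf hzx) hne] at h1
  exact ⟨g, hmem, (hX.hypSameSide_iff h).2 ⟨g, hg, hgg⟩,
    hg.2 z (left_mem_cliqueOf hzx) hne.symm⟩

/-- An edge of the carrier of `A` that is not dual to `A` spans a square with edges dual to
`A`. -/
lemma exists_inducedSquare_of_mem_hypCarrier (hX : IsQuasiMedian X) {A : Hyperplane X}
    {z z' x : V} (hzx : s(z, x) ∈ A.1) (hz' : z' ∈ hypCarrier X A) (hzz' : X.Adj z z')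
    (hn : s(z, z') ∉ A.1) : ∃ y, s(z', y) ∈ A.1 ∧ InducedSquare X z z' x y := by
  rw [hX.mem_iff_not_hypSameSide hzz', not_not] at hn
  have hs : ¬ HypSameSide X A x z' := fun h =>
    (hX.mem_iff_not_hypSameSide (adj hzx)).1 hzx (hn.trans h.symm)
  obtain ⟨y, hy, hsy, hd⟩ := hX.exists_of_not_hypSameSide hz' hs
  have d1 := hX.dist_of_hypSameSide hzx hn.symm
  have d2 := hX.dist_of_hypSameSide hy hn
  rw [SimpleGraph.dist_comm] at d1
  rw [SimpleGraph.dist_comm (u := z'), SimpleGraph.dist_eq_one_iff_adj.2 hzz'] at d1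
  rw [SimpleGraph.dist_eq_one_iff_adj.2 hzz'] at d2
  have ne : ∀ {p q}, X.dist p q = 1 + 1 → p ≠ q ∧ ¬ X.Adj p q := by
    intro p q h
    refine ⟨?_, fun k => ?_⟩
    · rintro rfl; simp at h
    · rw [SimpleGraph.dist_eq_one_iff_adj.2 k] at h; omega
  exact ⟨y, hy, hzz', SimpleGraph.dist_eq_one_iff_adj.1 (by omega), adj hzx, adj hy, (ne d2).2,
    fun h => (ne d1).2 h.symm, (ne d2).1, (ne d1).1.symm⟩

lemma hypIntersectAt_of_mem_hypCarrier (hX : IsQuasiMedian X) {A J : Hyperplane X} {x y : V}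
    (hJ : s(x, y) ∈ J.1) (hx : x ∈ hypCarrier X A) (hy : y ∈ hypCarrier X A) (hne : J ≠ A) :
    HypIntersectAt X J A x := by
  obtain ⟨x', hx'⟩ := exists_of_mem_hypCarrier hx
  obtain ⟨y', hy', hsq⟩ := hX.exists_inducedSquare_of_mem_hypCarrier hx' hy (adj hJ)
    (fun h => hne (eq_of_mem hJ h))
  exact ⟨_, hJ, _, hx', y, x', rfl, rfl, hsq.ab, hsq.ac, hsq.bc_ne, hsq.nbc, y',
    hsq.ad_ne.symm, hsq.bd, hsq.cd⟩

/-- Two hyperplanes that intersect somewhere intersect at every vertex common to their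
carriers. -/
lemma hypIntersectAt_of_hypIntersect (hX : IsQuasiMedian X) {A B : Hyperplane X} {p : V}
    (hne : A ≠ B) (hAB : HypIntersect X A B) (hA : p ∈ hypCarrier X A)
    (hB : p ∈ hypCarrier X B) : HypIntersectAt X A B p := by
  obtain ⟨q, _, ha, _, hb, a, b, rfl, rfl, hqa, hqb, hab, -, c, hcq, hac, hbc⟩ := hAB
  have hbcA : s(b, c) ∈ A.1 := mem_of_sideRel ha
    (.inr ⟨q, a, b, c, hqa, hbc, hqb, hac, hcq.symm, hab, rfl, rfl⟩)
  have hacB : s(a, c) ∈ B.1 := mem_of_sideRel hb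
    (.inr ⟨q, b, a, c, hqb, hac, hqa, hbc, hcq.symm, hab.symm, rfl, rfl⟩)
  have nA := (hX.mem_iff_not_hypSameSide hqa).1 ha
  have nA' := (hX.mem_iff_not_hypSameSide hbc).1 hbcA
  have nB := (hX.mem_iff_not_hypSameSide hqb).1 hb
  have nB' := (hX.mem_iff_not_hypSameSide hac).1 hacB
  have sA : HypSameSide X A q b := not_not.1
    (mt (hX.mem_iff_not_hypSameSide hqb).2 fun h => hne (eq_of_mem h hb))
  have sA' : HypSameSide X A a c := not_not.1
    (mt (hX.mem_iff_not_hypSameSide hac).2 fun h => hne (eq_of_mem h hacB))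
  have sB : HypSameSide X B q a := not_not.1
    (mt (hX.mem_iff_not_hypSameSide hqa).2 fun h => hne (eq_of_mem ha h))
  have sB' : HypSameSide X B b c := not_not.1
    (mt (hX.mem_iff_not_hypSameSide hbc).2 fun h => hne (eq_of_mem hbcA h))
  obtain ⟨r, hrA, hrB⟩ : ∃ r, ¬ HypSameSide X A r p ∧ ¬ HypSameSide X B r p := by
    by_cases h1 : HypSameSide X A q p <;> by_cases h2 : HypSameSide X B q p
    · exact ⟨c, fun h => nA (h1.trans (h.symm.trans sA'.symm)),
        fun h => nB (h2.trans (h.symm.trans sB'.symm))⟩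
    · exact ⟨a, fun h => nA (h1.trans h.symm), fun h => h2 (sB.trans h)⟩
    · exact ⟨b, fun h => h1 (sA.trans h), fun h => nB (h2.trans h.symm)⟩
    · exact ⟨q, h1, h2⟩
  obtain ⟨x, hx, -, hdx⟩ := hX.exists_of_not_hypSameSide hA hrA
  obtain ⟨y, hy, -, hdy⟩ := hX.exists_of_not_hypSameSide hB hrB
  have hxy : x ≠ y := by
    rintro rfl
    exact hne (eq_of_mem hx hy)
  have nxy : ¬ X.Adj x y := fun h =>
    hne (eq_of_mem (mem_of_sideRel hx (.inl ⟨p, x, y, adj hx, adj hy, h, rfl, rfl⟩)) hy)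
  obtain ⟨t, htx, hty, ht⟩ := hX.quadrangle_condition (w := r) (adj hx).symm (adj hy).symm hxy
    hdx.symm hdy.symm
  exact ⟨_, hx, _, hy, x, y, rfl, rfl, adj hx, adj hy, hxy, nxy, t,
    by rintro rfl; omega, htx.symm, hty.symm⟩

lemma mem_hypCarrier_of_hypSameSide (hX : IsQuasiMedian X) {A : Hyperplane X} {z p r : V}
    (hz : z ∈ hypCarrier X A) (hp : p ∈ hypCarrier X A) (hs : HypSameSide X A z p)
    (hzr : X.Adj z r) (hr : X.dist z p = X.dist r p + 1) : r ∈ hypCarrier X A := by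
  have c := fun p q => SimpleGraph.dist_comm (G := X) (u := p) (v := q)
  obtain ⟨x, hx⟩ := exists_of_mem_hypCarrier hz
  have hxp : ¬ HypSameSide X A x p := fun h =>
    (hX.mem_iff_not_hypSameSide (adj hx)).1 hx (hs.trans h.symm)
  obtain ⟨y, hy, hxy, d1⟩ := hX.exists_of_not_hypSameSide hp hxp
  have d2 := hX.dist_of_hypSameSide hx hs.symm
  have d3 := hX.dist_of_hypSameSide hy hs
  have l1 := hX.dist_le_of_adj r (adj hy).symm
  have l2 := hX.dist_le_of_adj y hzr
  rw [c p x, c p z] at d2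
  rw [c y z, c y r] at l2
  have hne : x ≠ r := by rintro rfl; omega
  obtain ⟨t, tx, tr, ht⟩ := hX.quadrangle_condition (w := y) (adj hx).symm hzr.symm hne
    (by rw [c y x, c y z]; omega) (by rw [c y r, c y z]; omega)
  refine left_mem_hypCarrier (mem_of_sideRel hx
    (.inr ⟨z, x, r, t, adj hx, tr.symm, hzr, tx.symm, ?_, hne, rfl, rfl⟩))
  rintro rfl
  rw [c y x, c y z] at ht
  omega

/-- Carriers are isometrically embedded. -/
lemma exists_mem_hypCarrier_closer (hX : IsQuasiMedian X) {A : Hyperplane X} {z p : V} {m : ℕ}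
    (hz : z ∈ hypCarrier X A) (hp : p ∈ hypCarrier X A) (hd : X.dist p z = m + 1) :
    ∃ r ∈ hypCarrier X A, X.Adj z r ∧ X.dist p r = m := by
  by_cases hs : HypSameSide X A z p
  · rw [SimpleGraph.dist_comm] at hd
    obtain ⟨r, hzr, hr⟩ := hX.exists_adj_closer hd
    exact ⟨r, hX.mem_hypCarrier_of_hypSameSide hz hp hs hzr (by omega), hzr,
      SimpleGraph.dist_comm.trans hr⟩
  · obtain ⟨r, h1, -, h3⟩ := hX.exists_of_not_hypSameSide hz fun h => hs h.symm
    exact ⟨r, right_mem_hypCarrier h1, adj h1, by omega⟩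

/-- Carriers are locally convex. -/
lemma mem_hypCarrier_of_common_adj (hX : IsQuasiMedian X) {A : Hyperplane X} {z z' r : V}
    (hz : z ∈ hypCarrier X A) (hz' : z' ∈ hypCarrier X A) (hne : z ≠ z') (hn : ¬ X.Adj z z')
    (hzr : X.Adj z r) (hz'r : X.Adj z' r) : r ∈ hypCarrier X A := by
  by_cases h1 : s(z, r) ∈ A.1
  · exact right_mem_hypCarrier h1
  by_cases h2 : s(z', r) ∈ A.1
  · exact right_mem_hypCarrier h2
  rw [hX.mem_iff_not_hypSameSide hzr, not_not] at h1
  rw [hX.mem_iff_not_hypSameSide hz'r, not_not] at h2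
  exact hX.mem_hypCarrier_of_hypSameSide hz hz' (h1.trans h2.symm) hzr
    (by rw [hX.dist_eq_two hne hn hzr hz'r, SimpleGraph.dist_eq_one_iff_adj.2 hz'r.symm])

/-- Carriers contain every triangle having an edge in them. -/
lemma mem_hypCarrier_of_triangle (hX : IsQuasiMedian X) {A : Hyperplane X} {z z' t : V}
    (hz : z ∈ hypCarrier X A) (hz' : z' ∈ hypCarrier X A) (hzz' : X.Adj z z')
    (htz : X.Adj t z) (htz' : X.Adj t z') : t ∈ hypCarrier X A := by
  by_cases h : s(z, z') ∈ A.1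
  · exact right_mem_hypCarrier (mem_of_sideRel h
      (.inl ⟨z, z', t, hzz', htz.symm, htz'.symm, rfl, rfl⟩))
  obtain ⟨x, hx⟩ := exists_of_mem_hypCarrier hz
  obtain ⟨y, hy, hsq⟩ := hX.exists_inducedSquare_of_mem_hypCarrier hx hz' hzz' h
  obtain ⟨t', -, hsq'⟩ := hX.exists_inducedSquare hsq (mem_cliqueOf.2 ⟨.inr htz, .inr htz'⟩)
    htz.ne
  exact left_mem_hypCarrier (mem_of_sideRel hx (.inr ⟨z, x, t, t', hsq'.ac, hsq'.bd, hsq'.ab,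
    hsq'.cd, hsq'.ad_ne, hsq'.bc_ne.symm, rfl, rfl⟩))

/-- Carriers are gated. -/
lemma dist_of_isNearest (hX : IsQuasiMedian X) {A : Hyperplane X} {p p' : V}
    (hp' : p' ∈ hypCarrier X A) (hmin : ∀ z ∈ hypCarrier X A, X.dist p p' ≤ X.dist p z) {m : ℕ} :
    ∀ z ∈ hypCarrier X A, X.dist p' z = m → X.dist p z = X.dist p p' + m := by
  induction m using Nat.strong_induction_on with
  | _ m ih =>
  rcases m with _ | m
  · intro z _ hd
    rw [hX.connected.dist_eq_zero_iff] at hd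
    rw [hd, add_zero]
  have not_closer : ∀ z ∈ hypCarrier X A, X.dist p' z = m + 1 →
      X.dist p z + 1 ≠ X.dist p p' + m := by
    intro z hz hd hpz
    obtain ⟨z₁, hz₁, hzz₁, hd₁⟩ := hX.exists_mem_hypCarrier_closer hz hp' hd
    have e₁ := ih m (by omega) z₁ hz₁ hd₁
    rcases m with _ | m
    · have := hmin z hz; omega
    obtain ⟨z₂, hz₂, hz₁₂, hd₂⟩ := hX.exists_mem_hypCarrier_closer hz₁ hp' hd₁
    have e₂ := ih m (by omega) z₂ hz₂ hd₂
    have hne : z ≠ z₂ := by rintro rfl; omega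
    have hnadj : ¬ X.Adj z z₂ := fun h => by have := hX.dist_le_of_adj p' h; omega
    obtain ⟨r, rz, rz₂, hr⟩ := hX.quadrangle_condition (w := p) hzz₁ hz₁₂.symm hne (by omega)
      (by omega)
    have hrA := hX.mem_hypCarrier_of_common_adj hz hz₂ hne hnadj rz.symm rz₂.symm
    have l1 := hX.dist_le_of_adj p' rz.symm
    have l2 := hX.dist_le_of_adj p' rz₂
    have := ih (m + 1) (by omega) r hrA (by omega)
    omega
  intro z hz hd
  obtain ⟨z₁, hz₁, hzz₁, hd₁⟩ := hX.exists_mem_hypCarrier_closer hz hp' hd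
  have e₁ := ih m (by omega) z₁ hz₁ hd₁
  have l1 := hX.dist_le_of_adj p hzz₁
  have l2 := hX.dist_le_of_adj p hzz₁.symm
  have hn := not_closer z hz hd
  by_contra hne
  obtain ⟨t, tz, tz₁, ht⟩ := hX.triangle_condition (w := p) hzz₁ (by omega)
  have htA := hX.mem_hypCarrier_of_triangle hz hz₁ hzz₁ tz tz₁
  have l3 := hX.dist_le_of_adj p' tz.symm
  have l4 := hX.dist_le_of_adj p' tz₁
  by_cases htm : X.dist p' t = m
  · have := ih m (by omega) t htA htm
    omega
  · exact not_closer t htA (by omega) (by omega)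

/-- A vertex outside a carrier is separated from it by a hyperplane whose carrier contains the
vertex. -/
lemma exists_separating_hyperplane (hX : IsQuasiMedian X) {A : Hyperplane X} {p : V}
    (hp : p ∉ hypCarrier X A) :
    ∃ J : Hyperplane X, p ∈ hypCarrier X J ∧ ∀ z ∈ hypCarrier X A, ¬ HypSameSide X J p z := by
  obtain ⟨a, b, hab⟩ := A.exists_mem
  obtain ⟨p', hp', hmin⟩ := (measure (X.dist p)).wf.has_min (hypCarrier X A)
    ⟨a, left_mem_hypCarrier hab⟩
  have hmin' : ∀ z ∈ hypCarrier X A, X.dist p p' ≤ X.dist p z := fun z hz => not_lt.1 (hmin z hz)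
  obtain ⟨n, hn⟩ : ∃ n, X.dist p p' = n + 1 := by
    refine Nat.exists_eq_succ_of_ne_zero fun h => hp ?_
    rwa [hX.connected.dist_eq_zero_iff.1 h]
  obtain ⟨q, hpq, hq⟩ := hX.exists_adj_closer hn
  refine ⟨ofAdj hpq, left_mem_hypCarrier (mem_ofAdj hpq), fun z hz hs => ?_⟩
  have h1 := hX.dist_of_hypSameSide (mem_ofAdj hpq) hs.symm
  have h2 := hX.dist_of_isNearest hp' hmin' z hz rfl
  have h3 := hX.connected.dist_triangle (u := q) (v := p') (w := z)
  rw [SimpleGraph.dist_comm, SimpleGraph.dist_comm (u := z)] at h1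
  omega

/-- A hyperplane separating two vertices of the carrier of `A` is `A` or intersects `A`. -/
lemma eq_or_adj_of_not_hypSameSide (hX : IsQuasiMedian X) {A J : Hyperplane X} {x : V} {m : ℕ}
    (hx : x ∈ hypCarrier X A) :
    ∀ y ∈ hypCarrier X A, X.dist x y = m → ¬ HypSameSide X J x y →
      J = A ∨ (crossingGraph X).Adj J A := by
  induction m with
  | zero =>
    intro y _ hd hs
    rw [hX.connected.dist_eq_zero_iff] at hd
    exact absurd (hd ▸ hX.hypSameSide_refl J x) hs
  | succ m ih =>
    intro y hy hd hs
    obtain ⟨r, hr, hyr, hdr⟩ := hX.exists_mem_hypCarrier_closer hy hx hd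
    by_cases h : HypSameSide X J x r
    · by_cases hJA : J = A
      · exact .inl hJA
      have hmem := (hX.mem_iff_not_hypSameSide (J := J) hyr).2 fun k => hs (h.trans k.symm)
      exact .inr ⟨hJA, .inl ⟨y, hX.hypIntersectAt_of_mem_hypCarrier hmem hy hr hJA⟩⟩
    · exact ih r hr hdr h

end IsQuasiMedian

lemma HypIntersectAt.symm {A B : Hyperplane X} {p : V} (h : HypIntersectAt X A B p) :
    HypIntersectAt X B A p := by
  obtain ⟨e, he, e', he', a, b, h1, h2, h3, h4, h5, h6, q, h7, h8, h9⟩ := h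
  exact ⟨e', he', e, he, b, a, h2, h1, h4, h3, h5.symm, fun k => h6 k.symm, q, h7, h9, h8⟩

lemma HypIntersectAt.mem_hypCarrier {A B : Hyperplane X} {p : V} (h : HypIntersectAt X A B p) :
    p ∈ hypCarrier X A ∧ p ∈ hypCarrier X B := by
  obtain ⟨e, he, e', he', a, b, rfl, rfl, -⟩ := h
  exact ⟨left_mem_hypCarrier he, left_mem_hypCarrier he'⟩

lemma hypIntersect_of_adj {A B : Hyperplane X} (h : (crossingGraph X).Adj A B) :
    HypIntersect X A B := by
  obtain ⟨-, h | ⟨p, hp⟩⟩ := h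
  · exact h
  · exact ⟨p, hp.symm⟩

namespace IsQuasiMedian

/-- A hyperplane separating `p` from the carrier at the end of a chain of successively
intersecting hyperplanes whose first carrier contains `p` equals or intersects an earlier member
of the chain. -/
lemma exists_eq_or_adj_of_chain (hX : IsQuasiMedian X) {J : Hyperplane X} {p : V}
    {g : ℕ → Hyperplane X} {s : ℕ} (h0 : p ∈ hypCarrier X (g 0)) (hs : 0 < s)
    (hadj : ∀ i < s, (crossingGraph X).Adj (g i) (g (i + 1)))
    (hsep : ∀ z ∈ hypCarrier X (g s), ¬ HypSameSide X J p z) :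
    ∃ k < s, J = g k ∨ (crossingGraph X).Adj J (g k) := by
  by_contra! hcon
  have same : ∀ k < s, ∀ x ∈ hypCarrier X (g k), ∀ y ∈ hypCarrier X (g k),
      HypSameSide X J x y := by
    intro k hk x hx y hy
    by_contra h
    obtain h | h := hX.eq_or_adj_of_not_hypSameSide hx y hy rfl h
    · exact (hcon k hk).1 h
    · exact (hcon k hk).2 h
  have key : ∀ k < s, ∀ z ∈ hypCarrier X (g k), HypSameSide X J p z := by
    intro k
    induction k with
    | zero => exact fun hk z hz => same 0 hk p h0 z hz
    | succ k ih =>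
      intro hk z hz
      obtain ⟨q, hq⟩ := hypIntersect_of_adj (hadj k (by omega))
      exact (ih (by omega) q hq.mem_hypCarrier.1).trans (same _ hk q hq.mem_hypCarrier.2 z hz)
  obtain ⟨q, hq⟩ := hypIntersect_of_adj (hadj (s - 1) (by omega))
  rw [Nat.sub_add_cancel hs] at hq
  exact hsep q hq.mem_hypCarrier.2 (key _ (by omega) q hq.mem_hypCarrier.1)

end IsQuasiMedian

lemma exists_walk_of_chain {W : Type*} {G : SimpleGraph W} {f : ℕ → W} {m : ℕ}
    (hadj : ∀ i < m, G.Adj (f i) (f (i + 1))) {i : ℕ} (n : ℕ) (h : i + n ≤ m) :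
    ∃ w : G.Walk (f i) (f (i + n)), w.length = n := by
  induction n with
  | zero => exact ⟨.nil, rfl⟩
  | succ n ih =>
    obtain ⟨w, hw⟩ := ih (by omega)
    exact ⟨w.concat (hadj (i + n) (by omega)), by simp [hw]⟩

lemma exists_walk_of_eq_or_adj {W : Type*} {G : SimpleGraph W} {u v : W} (h : u = v ∨ G.Adj u v) :
    ∃ w : G.Walk u v, w.length ≤ 1 ∧ (w.length = 1 → G.Adj u v) := by
  obtain rfl | h := h
  · exact ⟨.nil, by simp⟩
  · exact ⟨h.toWalk, by simp [h]⟩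

/-- A vertex equal or adjacent to vertices of a geodesic on both sides of the `s`-th one is
adjacent to the two neighbours of the latter on the geodesic. -/
lemma adj_of_geodesic {W : Type*} {G : SimpleGraph W} {f : ℕ → W} {m : ℕ}
    (hadj : ∀ i < m, G.Adj (f i) (f (i + 1))) (hm : m = G.dist (f 0) (f m)) {J : W}
    {k s l : ℕ} (hks : k < s) (hsl : s < l) (hlm : l ≤ m) (hk : J = f k ∨ G.Adj J (f k))
    (hl : J = f l ∨ G.Adj J (f l)) : G.Adj (f (s - 1)) J ∧ G.Adj J (f (s + 1)) := by
  obtain ⟨w₁, h₁⟩ := exists_walk_of_chain hadj (i := 0) k (by omega)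
  obtain ⟨w₂, h₂⟩ := exists_walk_of_chain hadj (i := l) (m - l) (by omega)
  obtain ⟨w₃, h₃, h₃'⟩ := exists_walk_of_eq_or_adj hk
  obtain ⟨w₄, h₄, h₄'⟩ := exists_walk_of_eq_or_adj hl
  have h := SimpleGraph.dist_le (((w₁.copy rfl (by rw [zero_add])).append w₃.reverse).append
    (w₄.append (w₂.copy rfl (by rw [Nat.add_sub_cancel' hlm]))))
  simp only [SimpleGraph.Walk.length_append, SimpleGraph.Walk.length_copy,
    SimpleGraph.Walk.length_reverse] at h
  obtain rfl : k = s - 1 := by omega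
  obtain rfl : l = s + 1 := by omega
  exact ⟨(h₃' (by omega)).symm, h₄' (by omega)⟩

namespace IsQuasiMedian

lemma exists_geodesic_through (hX : IsQuasiMedian X) {A B : Hyperplane X} {p : V}
    (hA : p ∈ hypCarrier X A) (hB : p ∈ hypCarrier X B)
    (hreach : (crossingGraph X).Reachable A B) (s : ℕ) :
    ∃ f : ℕ → Hyperplane X, f 0 = A ∧ f ((crossingGraph X).dist A B) = B ∧
      (∀ i < (crossingGraph X).dist A B, (crossingGraph X).Adj (f i) (f (i + 1))) ∧
      ∀ i < s, i ≤ (crossingGraph X).dist A B → p ∈ hypCarrier X (f i) := by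
  induction s with
  | zero =>
    obtain ⟨w, hw⟩ := hreach.exists_walk_length_eq_dist
    exact ⟨w.getVert, w.getVert_zero, hw ▸ w.getVert_length,
      fun i hi => w.adj_getVert_succ (hw ▸ hi), fun i hi => absurd hi (Nat.not_lt_zero i)⟩
  | succ s ih =>
    obtain ⟨f, f0, fm, hadj, hf⟩ := ih
    set m := (crossingGraph X).dist A B with hm
    by_cases hs : m < s ∨ p ∈ hypCarrier X (f s)
    · refine ⟨f, f0, fm, hadj, fun i hi him => ?_⟩
      obtain h | rfl := Nat.lt_succ_iff_lt_or_eq.1 hi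
      · exact hf i h him
      · exact hs.resolve_left (by omega)
    rw [not_or, not_lt] at hs
    have hs0 : 0 < s := Nat.pos_of_ne_zero (by rintro rfl; exact hs.2 (f0 ▸ hA))
    have hsm : s < m := lt_of_le_of_ne hs.1 (by rintro rfl; exact hs.2 (fm ▸ hB))
    obtain ⟨J, hpJ, hJ⟩ := hX.exists_separating_hyperplane hs.2
    obtain ⟨k, hk, hJk⟩ := hX.exists_eq_or_adj_of_chain (g := f) (f0 ▸ hA) hs0
      (fun i hi => hadj i (by omega)) hJ
    obtain ⟨l, hl, hJl⟩ := hX.exists_eq_or_adj_of_chain (g := fun i => f (m - i)) (s := m - s)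
      (by simpa [fm] using hB) (by omega)
      (fun i hi => by
        have h := (hadj (m - (i + 1)) (by omega)).symm
        rwa [show m - (i + 1) + 1 = m - i by omega] at h)
      (by simpa [Nat.sub_sub_self hs.1] using hJ)
    obtain ⟨h1, h2⟩ := adj_of_geodesic hadj (by rw [f0, fm]) hk (show s < m - l by omega)
      (by omega) hJk hJl
    refine ⟨Function.update f s J, ?_, ?_, fun i hi => ?_, fun i hi him => ?_⟩
    · rw [Function.update_of_ne hs0.ne, f0]
    · rw [Function.update_of_ne hsm.ne', fm]
    · by_cases his : i = s
      · subst his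
        rwa [Function.update_self, Function.update_of_ne (by omega)]
      by_cases his' : i + 1 = s
      · subst his'
        rw [Function.update_self, Function.update_of_ne (by omega)]
        simpa using h1
      · rw [Function.update_of_ne his, Function.update_of_ne his']
        exact hadj i hi
    · by_cases his : i = s
      · rwa [his, Function.update_self]
      · rw [Function.update_of_ne his]
        exact hf i (by omega) him

end IsQuasiMedian

end QM

namespace QM

/-- **Corollary (local osculation).** If hyperplanes `A` and `B` of a quasi-median graph `X`
osculate at `p` and lie in the same connected component of the crossing graph `ΔX`, then
there is a geodesic `A = A₀, …, A_m = B` in `ΔX` such that `A_{i-1}` and `A_i` intersect at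
`p` for all `1 ≤ i ≤ m`. -/
theorem local_osculation {V : Type*} (X : SimpleGraph V) (hX : IsQuasiMedian X)
    (A B : Hyperplane X) (p : V) (hosc : HypOsculateAt X A B p)
    (hreach : (crossingGraph X).Reachable A B) :
    ∃ (m : ℕ) (Aseq : ℕ → Hyperplane X),
      Aseq 0 = A ∧ Aseq m = B ∧ m = (crossingGraph X).dist A B ∧
      (∀ i < m, (crossingGraph X).Adj (Aseq i) (Aseq (i + 1))) ∧
      (∀ i < m, HypIntersectAt X (Aseq i) (Aseq (i + 1)) p) := by
  obtain ⟨e, he, e', he', a, b, rfl, rfl, -⟩ := hosc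
  obtain ⟨f, f0, fm, hadj, hf⟩ := hX.exists_geodesic_through (Hyperplane.left_mem_hypCarrier he)
    (Hyperplane.left_mem_hypCarrier he') hreach ((crossingGraph X).dist A B + 1)
  exact ⟨_, f, f0, fm, rfl, hadj, fun i hi => hX.hypIntersectAt_of_hypIntersect (hadj i hi).ne
    (hypIntersect_of_adj (hadj i hi)) (hf i (by omega) hi.le) (hf (i + 1) (by omega) hi)⟩

end QM
end
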